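/- arXiv:gr-qc/0703147 — 10 statements merged into one kernel-verified Lean document; each statement's English description precedes it below -/
import Mathlib

section
/- Let p ≥ 1 be an integer and C a real number. Define on ℝ the functions a₀(τ) = C·(1−τ)^{p+1}(1+τ)^{p−1}, a₁(τ) = C·√((p+1)/p)·(1−τ)^p(1+τ)^p, a₂(τ) = C·(1−τ)^{p−1}(1+τ)^{p+1}. Then for all τ ∈ ℝ the triple (a₀,a₁,a₂) satisfies the homogeneous order-p transport system: (1+τ)·a₀′ + √(p(p+1))·a₁ − (p−1)·a₀ = 0, a₁′ + (1/2)·√(p(p+1))·(a₂ − a₀) = 0, (1−τ)·a₂′ − √(p(p+1))·a₁ + (p−1)·a₂ = 0, and τ·a₁′ + (1/2)·√(p(p+1))·(a₂ + a₀) − p·a₁ = 0. Conversely, if differentiable functions (a₀,a₁,a₂) : (−1,1) → ℝ satisfy this system together with the regularity condition a₀(0) = a₂(0), then they are given by the above formulas with C = a₀(0). -/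
lemma const_aux (f : ℝ → ℝ) (h : ∀ t ∈ Set.Ioo (-1 : ℝ) 1, HasDerivAt f 0 t) :
    ∀ t ∈ Set.Ioo (-1 : ℝ) 1, f t = f 0 := by
  intro t ht
  refine IsOpen.is_const_of_deriv_eq_zero (s := Set.Ioo (-1 : ℝ) 1) isOpen_Ioo
    (convex_Ioo _ _).isPreconnected
    (fun x hx => (h x hx).differentiableAt.differentiableWithinAt)
    (fun x hx => (h x hx).deriv) ht (by norm_num)

lemma hasDeriv_aux (c : ℝ) (m n : ℕ) (t : ℝ) :
    HasDerivAt (fun t : ℝ => c * (1 - t) ^ m * (1 + t) ^ n)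
      (c * (m * (1 - t) ^ (m - 1) * (-1)) * (1 + t) ^ n
        + c * (1 - t) ^ m * (n * (1 + t) ^ (n - 1) * 1)) t := by
  have h1 : HasDerivAt (fun t : ℝ => 1 - t) (-1) t := (hasDerivAt_id t).const_sub 1
  have h2 : HasDerivAt (fun t : ℝ => 1 + t) 1 t := (hasDerivAt_id t).const_add 1
  exact ((h1.pow m).const_mul c).mul (h2.pow n)

lemma pow_aux (x : ℝ) (n : ℕ) : x * ((n : ℝ) * x ^ (n - 1)) = n * x ^ n := by
  cases n with
  | zero => simp
  | succ k => simp; ring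

/-- Proposition "order p": the explicit polynomial solution of the homogeneous
order-`p` transport system of the `2^p`-polar sector of the Maxwell equations
on the cylinder at spatial infinity, and the converse uniqueness statement
under the regularity condition `a₀ 0 = a₂ 0`. -/
theorem maxwell_order_p_transport_solution (p : ℕ) (hp : 1 ≤ p) :
    (∀ C : ℝ, ∀ τ : ℝ,
      (1 + τ) * deriv (fun t : ℝ => C * (1 - t) ^ (p + 1) * (1 + t) ^ (p - 1)) τ
          + Real.sqrt ((p : ℝ) * ((p : ℝ) + 1))
            * (C * Real.sqrt (((p : ℝ) + 1) / (p : ℝ)) * (1 - τ) ^ p * (1 + τ) ^ p)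
          - ((p : ℝ) - 1) * (C * (1 - τ) ^ (p + 1) * (1 + τ) ^ (p - 1)) = 0 ∧
      deriv (fun t : ℝ =>
            C * Real.sqrt (((p : ℝ) + 1) / (p : ℝ)) * (1 - t) ^ p * (1 + t) ^ p) τ
          + (1 / 2) * Real.sqrt ((p : ℝ) * ((p : ℝ) + 1))
            * (C * (1 - τ) ^ (p - 1) * (1 + τ) ^ (p + 1)
                - C * (1 - τ) ^ (p + 1) * (1 + τ) ^ (p - 1)) = 0 ∧
      (1 - τ) * deriv (fun t : ℝ => C * (1 - t) ^ (p - 1) * (1 + t) ^ (p + 1)) τ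
          - Real.sqrt ((p : ℝ) * ((p : ℝ) + 1))
            * (C * Real.sqrt (((p : ℝ) + 1) / (p : ℝ)) * (1 - τ) ^ p * (1 + τ) ^ p)
          + ((p : ℝ) - 1) * (C * (1 - τ) ^ (p - 1) * (1 + τ) ^ (p + 1)) = 0 ∧
      τ * deriv (fun t : ℝ =>
            C * Real.sqrt (((p : ℝ) + 1) / (p : ℝ)) * (1 - t) ^ p * (1 + t) ^ p) τ
          + (1 / 2) * Real.sqrt ((p : ℝ) * ((p : ℝ) + 1))
            * (C * (1 - τ) ^ (p - 1) * (1 + τ) ^ (p + 1)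
                + C * (1 - τ) ^ (p + 1) * (1 + τ) ^ (p - 1))
          - (p : ℝ) * (C * Real.sqrt (((p : ℝ) + 1) / (p : ℝ)) * (1 - τ) ^ p * (1 + τ) ^ p)
            = 0)
    ∧
    (∀ a₀ a₁ a₂ : ℝ → ℝ,
      (∀ τ ∈ Set.Ioo (-1 : ℝ) 1, DifferentiableAt ℝ a₀ τ) →
      (∀ τ ∈ Set.Ioo (-1 : ℝ) 1, DifferentiableAt ℝ a₁ τ) →
      (∀ τ ∈ Set.Ioo (-1 : ℝ) 1, DifferentiableAt ℝ a₂ τ) →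
      (∀ τ ∈ Set.Ioo (-1 : ℝ) 1,
        (1 + τ) * deriv a₀ τ + Real.sqrt ((p : ℝ) * ((p : ℝ) + 1)) * a₁ τ
            - ((p : ℝ) - 1) * a₀ τ = 0 ∧
        deriv a₁ τ + (1 / 2) * Real.sqrt ((p : ℝ) * ((p : ℝ) + 1)) * (a₂ τ - a₀ τ) = 0 ∧
        (1 - τ) * deriv a₂ τ - Real.sqrt ((p : ℝ) * ((p : ℝ) + 1)) * a₁ τ
            + ((p : ℝ) - 1) * a₂ τ = 0 ∧
        τ * deriv a₁ τ + (1 / 2) * Real.sqrt ((p : ℝ) * ((p : ℝ) + 1)) * (a₂ τ + a₀ τ)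
            - (p : ℝ) * a₁ τ = 0) →
      a₀ 0 = a₂ 0 →
      ∀ τ ∈ Set.Ioo (-1 : ℝ) 1,
        a₀ τ = a₀ 0 * (1 - τ) ^ (p + 1) * (1 + τ) ^ (p - 1) ∧
        a₁ τ = a₀ 0 * Real.sqrt (((p : ℝ) + 1) / (p : ℝ)) * (1 - τ) ^ p * (1 + τ) ^ p ∧
        a₂ τ = a₀ 0 * (1 - τ) ^ (p - 1) * (1 + τ) ^ (p + 1)) := by
  obtain ⟨n, rfl⟩ : ∃ n, p = n + 1 := ⟨p - 1, by omega⟩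
  have hq : (0 : ℝ) < ((n + 1 : ℕ) : ℝ) := by positivity
  have hqn : ((n + 1 : ℕ) : ℝ) = (n : ℝ) + 1 := by push_cast; ring
  have hn0 : (0 : ℝ) ≤ n := by positivity
  have hs2 : Real.sqrt (((n + 1 : ℕ) : ℝ) * (((n + 1 : ℕ) : ℝ) + 1)) ^ 2
      = ((n : ℝ) + 1) * (n + 2) := by
    rw [Real.sq_sqrt (by positivity), hqn]; ring
  have hr : Real.sqrt ((((n + 1 : ℕ) : ℝ) + 1) / ((n + 1 : ℕ) : ℝ))
      = Real.sqrt (((n + 1 : ℕ) : ℝ) * (((n + 1 : ℕ) : ℝ) + 1)) / (n + 1) := by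
    rw [← hqn, eq_div_iff hq.ne']
    nth_rewrite 3 [← Real.sqrt_sq hq.le]
    rw [← Real.sqrt_mul (by positivity)]
    congr 1
    field_simp
  rw [hr]
  generalize Real.sqrt (((n + 1 : ℕ) : ℝ) * (((n + 1 : ℕ) : ℝ) + 1)) = s at hs2 ⊢
  have hn1 : (n : ℝ) + 1 ≠ 0 := by positivity
  simp only [Nat.add_sub_cancel, hqn]
  obtain ⟨r, rfl⟩ : ∃ r, s = r * (n + 1) := ⟨s / (n + 1), by field_simp⟩
  have hr2 : r ^ 2 * (n + 1) = n + 2 := by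
    have : (n + 1) * (r ^ 2 * (n + 1)) = ((n : ℝ) + 1) * (n + 2) := by rw [← hs2]; ring
    exact mul_left_cancel₀ hn1 this
  rw [mul_div_assoc, div_self hn1, mul_one]
  constructor
  · intro C τ
    rw [(hasDeriv_aux C _ _ τ).deriv, (hasDeriv_aux (C * r) _ _ τ).deriv,
      (hasDeriv_aux C _ _ τ).deriv]
    have e1 := pow_aux (1 + τ) n
    have e2 := pow_aux (1 - τ) n
    simp only [Nat.add_sub_cancel]
    push_cast
    refine ⟨?_, ?_, ?_, ?_⟩
    · linear_combination (C * (1 - τ) ^ (n + 1 + 1)) * e1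
        + C * (1 - τ) ^ (n + 1) * (1 + τ) ^ (n + 1) * hr2
    · ring
    · linear_combination (- C * (1 + τ) ^ (n + 1 + 1)) * e2 * (-1) * (-1)
        - C * (1 - τ) ^ (n + 1) * (1 + τ) ^ (n + 1) * hr2
    · ring
  · intro a₀ a₁ a₂ d0 d1 d2 H h0
    have hr0 : r ≠ 0 := by
      rintro rfl
      norm_num at hr2; linarith
    have K1 : ∀ t ∈ Set.Ioo (-1 : ℝ) 1, a₁ t = r / 2 * ((1 - t) * a₂ t + (1 + t) * a₀ t) := by
      intro t ht
      obtain ⟨_, h2, _, h4⟩ := H t ht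
      apply mul_left_cancel₀ hn1
      linear_combination t * h2 - h4
    have W := const_aux (fun t => (1 + t) ^ 2 * a₀ t - (1 - t) ^ 2 * a₂ t) (by
      intro t ht
      have h1 : HasDerivAt (fun t : ℝ => 1 - t) (-1) t := (hasDerivAt_id t).const_sub 1
      have h2 : HasDerivAt (fun t : ℝ => 1 + t) 1 t := (hasDerivAt_id t).const_add 1
      have := ((h2.pow 2).mul (d0 t ht).hasDerivAt).sub ((h1.pow 2).mul (d2 t ht).hasDerivAt)
      refine this.congr_deriv ?_
      obtain ⟨E1, _, E3, _⟩ := H t ht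
      rw [K1 t ht] at E1 E3
      simp only [Pi.pow_apply]
      push_cast
      linear_combination (1 + t) * E1 - (1 - t) * E3
        - ((1 - t) * a₂ t + (1 + t) * a₀ t) * hr2)
    have W' : ∀ t ∈ Set.Ioo (-1 : ℝ) 1, (1 + t) ^ 2 * a₀ t = (1 - t) ^ 2 * a₂ t := by
      intro t ht
      have := W t ht
      simp only [h0] at this
      linarith
    have Q := const_aux (fun t => a₀ t / (1 * (1 - t) ^ (n + 2) * (1 + t) ^ n)) (by
      intro t ht
      have hu : 1 - t ≠ 0 := by linarith [ht.2]
      have hv : 1 + t ≠ 0 := by linarith [ht.1]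
      refine ((d0 t ht).hasDerivAt.div (hasDeriv_aux 1 (n + 2) n t) (by positivity)).congr_deriv ?_
      rw [div_eq_zero_iff]; left
      obtain ⟨E1, _, E3, _⟩ := H t ht
      rw [K1 t ht] at E1
      have w := W' t ht
      have e1 := pow_aux (1 + t) n
      simp only [show n + 2 - 1 = n + 1 from rfl]
      push_cast
      have E : (1 - t) * ((1 + t) * deriv a₀ t) = (n * (1 - t) - (n + 2) * (1 + t)) * a₀ t := by
        linear_combination (1 - t) * E1 + (n + 2) / 2 * w
          - ((1 - t) * a₂ t + (1 + t) * a₀ t) * (1 - t) / 2 * hr2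
      apply mul_left_cancel₀ hv
      linear_combination (1 - t) ^ (n + 1) * (1 + t) ^ n * E - a₀ t * (1 - t) ^ (n + 2) * e1)
    intro t ht
    have hu : 1 - t ≠ 0 := by linarith [ht.2]
    have hv : 1 + t ≠ 0 := by linarith [ht.1]
    have R0 : a₀ t = a₀ 0 * (1 - t) ^ (n + 2) * (1 + t) ^ n := by
      have := Q t ht
      simp only [sub_zero, add_zero, one_pow, mul_one, div_one, one_mul] at this
      rw [div_eq_iff (by positivity)] at this
      rw [this]; ring
    have R2 : a₂ t = a₀ 0 * (1 - t) ^ n * (1 + t) ^ (n + 2) := by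
      apply mul_left_cancel₀ (pow_ne_zero 2 hu)
      rw [← W' t ht, R0]; ring
    refine ⟨R0, ?_, R2⟩
    rw [K1 t ht, R0, R2]; ring
end

section
/- Let p ≥ 1 be an integer. A twice differentiable function a : (−1,1) → ℝ satisfies the degenerate Jacobi equation (1−τ²)·a″(τ) + (2 − (2−2p)τ)·a′(τ) + 2p·a(τ) = 0 on (−1,1) if and only if there exist real constants C₁, C₂ such that for all τ ∈ (−1,1): a(τ) = ((1−τ)/2)^{p+1}·((1+τ)/2)^{p−1}·( C₁ + C₂·∫₀^τ ds/((1+s)^p (1−s)^{p+2}) ). -/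
lemma dj_const (f : ℝ → ℝ) (h : ∀ τ ∈ Set.Ioo (-1 : ℝ) 1, HasDerivAt f 0 τ) :
    ∀ τ ∈ Set.Ioo (-1 : ℝ) 1, f τ = f 0 := by
  intro τ hτ
  exact isOpen_Ioo.is_const_of_deriv_eq_zero isPreconnected_Ioo
    (fun x hx => (h x hx).differentiableAt.differentiableWithinAt)
    (fun x hx => (h x hx).deriv) hτ (by norm_num)

lemma dj_W (m : ℕ) (τ : ℝ) : ∃ w', HasDerivAt
    (fun t : ℝ => ((1 - t) / 2) ^ (m + 2) * ((1 + t) / 2) ^ m) w' τ ∧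
    (1 - τ ^ 2) * w' = -(2 + 2 * ((m : ℝ) + 1) * τ) *
      (((1 - τ) / 2) ^ (m + 2) * ((1 + τ) / 2) ^ m) := by
  have h1 : HasDerivAt (fun t : ℝ => (1 - t) / 2) (-1 / 2) τ :=
    ((hasDerivAt_id τ).const_sub 1).div_const 2
  have h2 : HasDerivAt (fun t : ℝ => (1 + t) / 2) (1 / 2) τ :=
    ((hasDerivAt_id τ).const_add 1).div_const 2
  refine ⟨_, (h1.pow (m + 2)).mul (h2.pow m), ?_⟩
  rcases m with _ | k
  · simp; ring
  · simp only [Pi.pow_apply, Nat.add_sub_cancel, show k + 1 + 2 - 1 = k + 2 from rfl]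
    push_cast
    ring

lemma dj_I (m : ℕ) (τ : ℝ) (hτ : τ ∈ Set.Ioo (-1 : ℝ) 1) : HasDerivAt
    (fun t : ℝ => ∫ s in (0 : ℝ)..t, 1 / ((1 + s) ^ (m + 1) * (1 - s) ^ (m + 1 + 2)))
    (1 / ((1 + τ) ^ (m + 1) * (1 - τ) ^ (m + 1 + 2))) τ := by
  have hc : ContinuousOn (fun s : ℝ => 1 / ((1 + s) ^ (m + 1) * (1 - s) ^ (m + 1 + 2)))
      (Set.Ioo (-1 : ℝ) 1) := by
    refine ContinuousOn.div (by fun_prop) (by fun_prop) ?_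
    intro s hs
    have h1 : 0 < 1 + s := by linarith [hs.1]
    have h2 : 0 < 1 - s := by linarith [hs.2]
    positivity
  have hs : Set.uIcc 0 τ ⊆ Set.Ioo (-1 : ℝ) 1 :=
    Set.ordConnected_Ioo.uIcc_subset (by norm_num) hτ
  refine intervalIntegral.integral_hasDerivAt_right ((hc.mono hs).intervalIntegrable) ?_ ?_
  · exact hc.stronglyMeasurableAtFilter isOpen_Ioo _ hτ
  · exact hc.continuousAt (isOpen_Ioo.mem_nhds hτ)

/-- General solution of the degenerate Jacobi equation governing the `2^p`-polar
sector of the order-`p` Maxwell transport equations: a twice differentiable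
function on `(-1,1)` solves the ODE iff it has the displayed integral form. -/
theorem degenerate_jacobi_general_solution (p : ℕ) (hp : 1 ≤ p) (a : ℝ → ℝ)
    (hd₁ : ∀ τ ∈ Set.Ioo (-1 : ℝ) 1, DifferentiableAt ℝ a τ)
    (hd₂ : ∀ τ ∈ Set.Ioo (-1 : ℝ) 1, DifferentiableAt ℝ (deriv a) τ) :
    (∀ τ ∈ Set.Ioo (-1 : ℝ) 1,
        (1 - τ ^ 2) * deriv (deriv a) τ + (2 - (2 - 2 * (p : ℝ)) * τ) * deriv a τ
          + 2 * (p : ℝ) * a τ = 0)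
    ↔ ∃ C₁ C₂ : ℝ, ∀ τ ∈ Set.Ioo (-1 : ℝ) 1,
        a τ = ((1 - τ) / 2) ^ (p + 1) * ((1 + τ) / 2) ^ (p - 1)
          * (C₁ + C₂ * ∫ s in (0 : ℝ)..τ, 1 / ((1 + s) ^ p * (1 - s) ^ (p + 2))) := by
  obtain ⟨m, rfl⟩ : ∃ m, p = m + 1 := ⟨p - 1, by omega⟩
  simp only [Nat.add_sub_cancel, show m + 1 + 1 = m + 2 from rfl]
  have hL : ∀ τ ∈ Set.Ioo (-1 : ℝ) 1, HasDerivAt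
      (fun t => (1 - t ^ 2) * deriv a t + (2 + 2 * ((m : ℝ) + 1) * t) * a t)
      ((1 - τ ^ 2) * deriv (deriv a) τ + (2 - (2 - 2 * ((m + 1 : ℕ) : ℝ)) * τ) * deriv a τ
          + 2 * ((m + 1 : ℕ) : ℝ) * a τ) τ := by
    intro τ hτ
    have h1 : HasDerivAt (fun t : ℝ => 1 - t ^ 2) (-(2 * τ)) τ := by
      simpa using (hasDerivAt_pow 2 τ).const_sub 1
    have h2 : HasDerivAt (fun t : ℝ => 2 + 2 * ((m : ℝ) + 1) * t) (2 * ((m : ℝ) + 1)) τ := by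
      simpa using ((hasDerivAt_id τ).const_mul (2 * ((m : ℝ) + 1))).const_add 2
    refine ((h1.mul (hd₂ τ hτ).hasDerivAt).add (h2.mul (hd₁ τ hτ).hasDerivAt)).congr_deriv ?_
    push_cast
    ring
  have hWp : ∀ τ ∈ Set.Ioo (-1 : ℝ) 1, 0 < ((1 - τ) / 2) ^ (m + 2) * ((1 + τ) / 2) ^ m := by
    intro s hs
    have h1 : 0 < 1 + s := by linarith [hs.1]
    have h2 : 0 < 1 - s := by linarith [hs.2]
    positivity
  have hP : ∀ τ ∈ Set.Ioo (-1 : ℝ) 1,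
      4 ^ (m + 1) * ((1 - τ ^ 2) * (((1 - τ) / 2) ^ (m + 2) * ((1 + τ) / 2) ^ m)) *
      (1 / ((1 + τ) ^ (m + 1) * (1 - τ) ^ (m + 1 + 2))) = 1 := by
    intro s hs
    have h1 : 1 + s ≠ 0 := by linarith [hs.1]
    have h2 : 1 - s ≠ 0 := by linarith [hs.2]
    have h4 : (4 : ℝ) ^ (m + 1) = 2 ^ (m + 2) * 2 ^ m := by
      rw [← pow_add, show (4 : ℝ) = 2 ^ 2 by norm_num, ← pow_mul]
      congr 1
      ring
    rw [h4, div_pow, div_pow, show 1 - s ^ 2 = (1 - s) * (1 + s) by ring]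
    field_simp
    ring
  constructor
  · intro h
    have hK := dj_const _ (fun τ hτ => (hL τ hτ).congr_deriv (h τ hτ))
    generalize (1 - (0:ℝ) ^ 2) * deriv a 0 + (2 + 2 * ((m : ℝ) + 1) * 0) * a 0 = K at hK
    have hg := dj_const (fun t => a t / (((1 - t) / 2) ^ (m + 2) * ((1 + t) / 2) ^ m)
      - 4 ^ (m + 1) * K *
        ∫ s in (0 : ℝ)..t, 1 / ((1 + s) ^ (m + 1) * (1 - s) ^ (m + 1 + 2))) (by
      intro τ hτ
      obtain ⟨w', hw, hw'⟩ := dj_W m τ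
      have hW := hWp τ hτ
      have hPτ := hP τ hτ
      have hKτ := hK τ hτ
      have h1 : 0 < 1 - τ ^ 2 := by nlinarith [hτ.1, hτ.2]
      refine (((hd₁ τ hτ).hasDerivAt.div hw hW.ne').sub
        ((dj_I m τ hτ).const_mul (4 ^ (m + 1) * K))).congr_deriv ?_
      generalize 1 / ((1 + τ) ^ (m + 1) * (1 - τ) ^ (m + 1 + 2)) = R at *
      generalize ((1 - τ) / 2) ^ (m + 2) * ((1 + τ) / 2) ^ m = W at *
      rw [sub_eq_zero, div_eq_iff (by positivity)]
      apply mul_left_cancel₀ h1.ne'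
      linear_combination (-a τ) * hw' + W * hKτ - K * W * hPτ)
    refine ⟨a 0 / (((1 - 0) / 2) ^ (m + 2) * ((1 + 0) / 2) ^ m) - 4 ^ (m + 1) * K *
      ∫ s in (0 : ℝ)..0, 1 / ((1 + s) ^ (m + 1) * (1 - s) ^ (m + 1 + 2)),
      4 ^ (m + 1) * K, fun τ hτ => ?_⟩
    rw [← sub_eq_iff_eq_add.1 (hg τ hτ), mul_div_cancel₀ _ (hWp τ hτ).ne']
  · rintro ⟨C₁, C₂, h⟩ τ hτ
    have hc : ∀ t ∈ Set.Ioo (-1 : ℝ) 1,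
        (1 - t ^ 2) * deriv a t + (2 + 2 * ((m : ℝ) + 1) * t) * a t = C₂ / 4 ^ (m + 1) := by
      intro t ht
      obtain ⟨w', hw, hw'⟩ := dj_W m t
      have hPt := hP t ht
      have hd := (hw.mul (((dj_I m t ht).const_mul C₂).const_add C₁)).congr_of_eventuallyEq
        (f₁ := a) (Filter.eventually_of_mem (isOpen_Ioo.mem_nhds ht) h)
      rw [hd.deriv, h t ht, eq_div_iff (by positivity)]
      linear_combination 4 ^ (m + 1) * (C₁ + C₂ * ∫ s in (0 : ℝ)..t,
        1 / ((1 + s) ^ (m + 1) * (1 - s) ^ (m + 1 + 2))) * hw' + C₂ * hPt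
    refine (hL τ hτ).unique ?_
    exact (hasDerivAt_const τ (C₂ / 4 ^ (m + 1))).congr_of_eventuallyEq
      (Filter.eventually_of_mem (isOpen_Ioo.mem_nhds hτ) hc)
end

section
/- Let p ≥ 1 be an integer and let a : (−1,1) → ℝ be twice differentiable. Define w(τ) = ((1−τ)/2)^{p+1}·((1+τ)/2)^{p−1}·a(τ). Then for all τ ∈ (−1,1): (1−τ²)·w″(τ) + (2 − (2−2p)τ)·w′(τ) + 2p·w(τ) = ((1−τ)/2)^{p+1}·((1+τ)/2)^{p−1}·[ (1−τ²)·a″(τ) + (−2 − (2p+2)τ)·a′(τ) ]. -/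
theorem jacobi_weight_deriv (q : ℕ) (t : ℝ) (ht : t ∈ Set.Ioo (-1 : ℝ) 1) :
    HasDerivAt (fun t : ℝ => ((1 - t) / 2) ^ (q + 1 + 1) * ((1 + t) / 2) ^ q)
      (((1 - t) / 2) ^ (q + 1 + 1) * ((1 + t) / 2) ^ q
        * ((-2 - 2 * ((q : ℝ) + 1) * t) / (1 - t ^ 2))) t := by
  have h1 : HasDerivAt (fun t : ℝ => (1 - t) / 2) (-1 / 2) t :=
    ((hasDerivAt_id t).const_sub 1).div_const 2
  have h2 : HasDerivAt (fun t : ℝ => (1 + t) / 2) (1 / 2) t :=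
    ((hasDerivAt_id t).const_add 1).div_const 2
  have h := (h1.fun_pow (q + 1 + 1)).fun_mul (h2.fun_pow q)
  refine h.congr_deriv ?_
  have hu : 1 - t ≠ 0 := by linarith [ht.2]
  have hv : 1 + t ≠ 0 := by linarith [ht.1]
  have e : 1 - t ^ 2 = (1 - t) * (1 + t) := by ring
  rw [e]
  rcases q with _ | q
  · simp
    field_simp
    ring
  · simp only [Nat.add_sub_cancel]
    push_cast
    simp only [pow_succ]
    field_simp
    ring

/-- Conjugation identity for the Jacobi operator:
`D_{(2p,-p-1,-p+1)}(((1-τ)/2)^(p+1)((1+τ)/2)^(p-1) a)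
  = ((1-τ)/2)^(p+1)((1+τ)/2)^(p-1) D_{(0,p+1,p-1)} a`. -/
theorem jacobi_conjugation_identity (p : ℕ) (hp : 1 ≤ p) (a : ℝ → ℝ)
    (hd₁ : ∀ τ ∈ Set.Ioo (-1 : ℝ) 1, DifferentiableAt ℝ a τ)
    (hd₂ : ∀ τ ∈ Set.Ioo (-1 : ℝ) 1, DifferentiableAt ℝ (deriv a) τ) :
    ∀ τ ∈ Set.Ioo (-1 : ℝ) 1,
      (1 - τ ^ 2)
          * deriv (deriv (fun t : ℝ => ((1 - t) / 2) ^ (p + 1) * ((1 + t) / 2) ^ (p - 1) * a t)) τ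
        + (2 - (2 - 2 * (p : ℝ)) * τ)
          * deriv (fun t : ℝ => ((1 - t) / 2) ^ (p + 1) * ((1 + t) / 2) ^ (p - 1) * a t) τ
        + 2 * (p : ℝ) * (((1 - τ) / 2) ^ (p + 1) * ((1 + τ) / 2) ^ (p - 1) * a τ)
      = ((1 - τ) / 2) ^ (p + 1) * ((1 + τ) / 2) ^ (p - 1)
          * ((1 - τ ^ 2) * deriv (deriv a) τ + (-2 - (2 * (p : ℝ) + 2) * τ) * deriv a τ) := by
  intro τ hτ
  obtain ⟨q, rfl⟩ : ∃ q, p = q + 1 := ⟨p - 1, by omega⟩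
  simp only [Nat.add_sub_cancel]
  set W : ℝ → ℝ := fun t => ((1 - t) / 2) ^ (q + 1 + 1) * ((1 + t) / 2) ^ q with hWdef
  have hW : ∀ t ∈ Set.Ioo (-1 : ℝ) 1, HasDerivAt W
      (W t * ((-2 - 2 * ((q : ℝ) + 1) * t) / (1 - t ^ 2))) t :=
    fun t ht => jacobi_weight_deriv q t ht
  have hw : ∀ t ∈ Set.Ioo (-1 : ℝ) 1, HasDerivAt (fun t => W t * a t)
      (W t * ((-2 - 2 * ((q : ℝ) + 1) * t) / (1 - t ^ 2)) * a t + W t * deriv a t) t :=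
    fun t ht => (hW t ht).mul (hd₁ t ht).hasDerivAt
  have hpos : 1 - τ ^ 2 ≠ 0 := by
    have := hτ.1
    have := hτ.2
    nlinarith
  have hk : HasDerivAt (fun t : ℝ => (-2 - 2 * ((q : ℝ) + 1) * t) / (1 - t ^ 2))
      (((-(2 * ((q : ℝ) + 1))) * (1 - τ ^ 2) - (-2 - 2 * ((q : ℝ) + 1) * τ) * (-(2 * τ)))
        / (1 - τ ^ 2) ^ 2) τ := by
    refine HasDerivAt.fun_div ?_ ?_ hpos
    · simpa using ((hasDerivAt_id τ).const_mul (2 * ((q : ℝ) + 1))).const_sub (-2)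
    · simpa using ((hasDerivAt_id τ).pow 2).const_sub 1
  have he : deriv (fun t => W t * a t) =ᶠ[nhds τ] fun t =>
      W t * ((-2 - 2 * ((q : ℝ) + 1) * t) / (1 - t ^ 2)) * a t + W t * deriv a t := by
    filter_upwards [isOpen_Ioo.mem_nhds hτ] with t ht
    exact (hw t ht).deriv
  have h2 := ((((hW τ hτ).fun_mul hk).fun_mul (hd₁ τ hτ).hasDerivAt).fun_add
    ((hW τ hτ).fun_mul (hd₂ τ hτ).hasDerivAt)).deriv
  change (1 - τ ^ 2) * deriv (deriv (fun t => W t * a t)) τ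
    + (2 - (2 - 2 * ((q + 1 : ℕ) : ℝ)) * τ) * deriv (fun t => W t * a t) τ
    + 2 * ((q + 1 : ℕ) : ℝ) * (W τ * a τ) = W τ * _
  rw [he.deriv_eq, h2, (hw τ hτ).deriv]
  clear_value W
  push_cast
  field_simp
  ring
end

section
/- Let p ≥ 1 and 1 ≤ q ≤ p be integers and let (a₀,a₂) : (−1,1) → ℝ be a differentiable solution of the homogeneous system S_{p,q}. Then a₀ and a₂ are twice differentiable and satisfy on (−1,1): (1−τ²)·a₀″ + (2 − (2−2p)τ)·a₀′ + (q+p)(q−p+1)·a₀ = 0 and (1−τ²)·a₂″ + (−2 − (2−2p)τ)·a₂′ + (q+p)(q−p+1)·a₂ = 0. -/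
theorem aux_Spq (c P : ℝ) (a₀ a₂ : ℝ → ℝ)
    (hd₀ : ∀ τ ∈ Set.Ioo (-1 : ℝ) 1, DifferentiableAt ℝ a₀ τ)
    (hd₂ : ∀ τ ∈ Set.Ioo (-1 : ℝ) 1, DifferentiableAt ℝ a₂ τ)
    (heq₀ : ∀ τ ∈ Set.Ioo (-1 : ℝ) 1,
      (1 + τ) * deriv a₀ τ + (c * (1 + τ) - P + 1) * a₀ τ + c * (1 - τ) * a₂ τ = 0)
    (heq₂ : ∀ τ ∈ Set.Ioo (-1 : ℝ) 1,
      (1 - τ) * deriv a₂ τ - c * (1 + τ) * a₀ τ + (-c * (1 - τ) + P - 1) * a₂ τ = 0) :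
    ∀ τ ∈ Set.Ioo (-1 : ℝ) 1, DifferentiableAt ℝ (deriv a₀) τ ∧
      DifferentiableAt ℝ (deriv a₂) τ ∧
      (1 - τ ^ 2) * deriv (deriv a₀) τ + (2 - (2 - 2 * P) * τ) * deriv a₀ τ
        + (2 * c * P - P * (P - 1)) * a₀ τ = 0 ∧
      (1 - τ ^ 2) * deriv (deriv a₂) τ + (-2 - (2 - 2 * P) * τ) * deriv a₂ τ
        + (2 * c * P - P * (P - 1)) * a₂ τ = 0 := by
  intro τ hτ
  have hn : Set.Ioo (-1 : ℝ) 1 ∈ nhds τ := isOpen_Ioo.mem_nhds hτ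
  have hu : 1 + τ ≠ 0 := by have := hτ.1; linarith
  have hv : 1 - τ ≠ 0 := by have := hτ.2; linarith
  have h0 := hd₀ τ hτ
  have h2 := hd₂ τ hτ
  have D0 : DifferentiableAt ℝ (deriv a₀) τ := by
    have e : deriv a₀ =ᶠ[nhds τ]
        fun t => -((c * (1 + t) - P + 1) * a₀ t + c * (1 - t) * a₂ t) / (1 + t) := by
      filter_upwards [hn] with t ht
      have hu : 1 + t ≠ 0 := by have := ht.1; linarith
      rw [eq_div_iff hu]
      linarith [heq₀ t ht]
    refine DifferentiableAt.congr_of_eventuallyEq ?_ e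
    fun_prop (disch := assumption)
  have D2 : DifferentiableAt ℝ (deriv a₂) τ := by
    have e : deriv a₂ =ᶠ[nhds τ]
        fun t => (c * (1 + t) * a₀ t - (-c * (1 - t) + P - 1) * a₂ t) / (1 - t) := by
      filter_upwards [hn] with t ht
      have hu : 1 - t ≠ 0 := by have := ht.2; linarith
      rw [eq_div_iff hu]
      linarith [heq₂ t ht]
    refine DifferentiableAt.congr_of_eventuallyEq ?_ e
    fun_prop (disch := assumption)
  have hp : HasDerivAt (fun t : ℝ => 1 + t) 1 τ := (hasDerivAt_id τ).const_add 1
  have hm : HasDerivAt (fun t : ℝ => 1 - t) (-1) τ := (hasDerivAt_id τ).const_sub 1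
  have F0 := ((hp.mul D0.hasDerivAt).add
    ((((hp.const_mul c).sub_const P).add_const 1).mul h0.hasDerivAt)).add
    ((hm.const_mul c).mul h2.hasDerivAt)
  have F2 := ((hm.mul D2.hasDerivAt).sub
    ((hp.const_mul c).mul h0.hasDerivAt)).add
    ((((hm.const_mul (-c)).add_const P).sub_const 1).mul h2.hasDerivAt)
  have Z0 := F0.unique ((hasDerivAt_const τ (0 : ℝ)).congr_of_eventuallyEq
    (by filter_upwards [hn] with t ht using heq₀ t ht))
  have Z2 := F2.unique ((hasDerivAt_const τ (0 : ℝ)).congr_of_eventuallyEq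
    (by filter_upwards [hn] with t ht using heq₂ t ht))
  have E0 := heq₀ τ hτ
  have E2 := heq₂ τ hτ
  refine ⟨D0, D2, ?_, ?_⟩
  · linear_combination (1 - τ) * Z0 - c * (1 - τ) * E2 - (c * (1 - τ) - P) * E0
  · linear_combination (1 + τ) * Z2 + c * (1 + τ) * E0 + (c * (1 + τ) - P) * E2

/-- Solutions of the homogeneous system `S_{p,q}` are twice differentiable and
their components satisfy the associated second-order Jacobi equations. -/
theorem Spq_implies_jacobi_equations (p q : ℕ) (hp : 1 ≤ p) (hq₁ : 1 ≤ q) (hq₂ : q ≤ p)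
    (a₀ a₂ : ℝ → ℝ)
    (hd₀ : ∀ τ ∈ Set.Ioo (-1 : ℝ) 1, DifferentiableAt ℝ a₀ τ)
    (hd₂ : ∀ τ ∈ Set.Ioo (-1 : ℝ) 1, DifferentiableAt ℝ a₂ τ)
    (heq₀ : ∀ τ ∈ Set.Ioo (-1 : ℝ) 1,
      (1 + τ) * deriv a₀ τ
        + ((q : ℝ) * ((q : ℝ) + 1) / (2 * (p : ℝ)) * (1 + τ) - (p : ℝ) + 1) * a₀ τ
        + (q : ℝ) * ((q : ℝ) + 1) / (2 * (p : ℝ)) * (1 - τ) * a₂ τ = 0)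
    (heq₂ : ∀ τ ∈ Set.Ioo (-1 : ℝ) 1,
      (1 - τ) * deriv a₂ τ
        - (q : ℝ) * ((q : ℝ) + 1) / (2 * (p : ℝ)) * (1 + τ) * a₀ τ
        + (-((q : ℝ) * ((q : ℝ) + 1) / (2 * (p : ℝ))) * (1 - τ) + (p : ℝ) - 1) * a₂ τ = 0) :
    (∀ τ ∈ Set.Ioo (-1 : ℝ) 1, DifferentiableAt ℝ (deriv a₀) τ) ∧
    (∀ τ ∈ Set.Ioo (-1 : ℝ) 1, DifferentiableAt ℝ (deriv a₂) τ) ∧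
    (∀ τ ∈ Set.Ioo (-1 : ℝ) 1,
      (1 - τ ^ 2) * deriv (deriv a₀) τ + (2 - (2 - 2 * (p : ℝ)) * τ) * deriv a₀ τ
        + ((q : ℝ) + (p : ℝ)) * ((q : ℝ) - (p : ℝ) + 1) * a₀ τ = 0) ∧
    (∀ τ ∈ Set.Ioo (-1 : ℝ) 1,
      (1 - τ ^ 2) * deriv (deriv a₂) τ + (-2 - (2 - 2 * (p : ℝ)) * τ) * deriv a₂ τ
        + ((q : ℝ) + (p : ℝ)) * ((q : ℝ) - (p : ℝ) + 1) * a₂ τ = 0) := by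
  have hp0 : (p : ℝ) ≠ 0 := by
    have : p ≠ 0 := by omega
    exact_mod_cast this
  have H := aux_Spq ((q : ℝ) * ((q : ℝ) + 1) / (2 * (p : ℝ))) p a₀ a₂ hd₀ hd₂ heq₀ heq₂
  have hc : 2 * ((q : ℝ) * ((q : ℝ) + 1) / (2 * (p : ℝ))) * p - p * (p - 1)
      = ((q : ℝ) + (p : ℝ)) * ((q : ℝ) - (p : ℝ) + 1) := by
    field_simp
    ring
  rw [hc] at H
  exact ⟨fun t ht => (H t ht).1, fun t ht => (H t ht).2.1, fun t ht => (H t ht).2.2.1,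
    fun t ht => (H t ht).2.2.2⟩
end

section
/- Let p ≥ 1 and 1 ≤ q ≤ p be integers and let (a₀,a₂) and (ã₀,ã₂) be two differentiable solutions of the homogeneous system S_{p,q} on (−1,1). Then their Wronskian determinant satisfies, for all τ ∈ (−1,1): a₀(τ)·ã₂(τ) − a₂(τ)·ã₀(τ) = ( a₀(0)·ã₂(0) − a₂(0)·ã₀(0) ) · (1−τ²)^{p−1}. -/
/-- The Wronskian determinant of two solutions of the homogeneous system `S_{p,q}`
equals its value at `τ = 0` times `(1-τ²)^(p-1)`. -/
theorem Spq_wronskian (p q : ℕ) (hp : 1 ≤ p) (hq₁ : 1 ≤ q) (hq₂ : q ≤ p)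
    (a₀ a₂ b₀ b₂ : ℝ → ℝ)
    (hda₀ : ∀ τ ∈ Set.Ioo (-1 : ℝ) 1, DifferentiableAt ℝ a₀ τ)
    (hda₂ : ∀ τ ∈ Set.Ioo (-1 : ℝ) 1, DifferentiableAt ℝ a₂ τ)
    (hdb₀ : ∀ τ ∈ Set.Ioo (-1 : ℝ) 1, DifferentiableAt ℝ b₀ τ)
    (hdb₂ : ∀ τ ∈ Set.Ioo (-1 : ℝ) 1, DifferentiableAt ℝ b₂ τ)
    (heqa₀ : ∀ τ ∈ Set.Ioo (-1 : ℝ) 1,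
      (1 + τ) * deriv a₀ τ
        + ((q : ℝ) * ((q : ℝ) + 1) / (2 * (p : ℝ)) * (1 + τ) - (p : ℝ) + 1) * a₀ τ
        + (q : ℝ) * ((q : ℝ) + 1) / (2 * (p : ℝ)) * (1 - τ) * a₂ τ = 0)
    (heqa₂ : ∀ τ ∈ Set.Ioo (-1 : ℝ) 1,
      (1 - τ) * deriv a₂ τ
        - (q : ℝ) * ((q : ℝ) + 1) / (2 * (p : ℝ)) * (1 + τ) * a₀ τ
        + (-((q : ℝ) * ((q : ℝ) + 1) / (2 * (p : ℝ))) * (1 - τ) + (p : ℝ) - 1) * a₂ τ = 0)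
    (heqb₀ : ∀ τ ∈ Set.Ioo (-1 : ℝ) 1,
      (1 + τ) * deriv b₀ τ
        + ((q : ℝ) * ((q : ℝ) + 1) / (2 * (p : ℝ)) * (1 + τ) - (p : ℝ) + 1) * b₀ τ
        + (q : ℝ) * ((q : ℝ) + 1) / (2 * (p : ℝ)) * (1 - τ) * b₂ τ = 0)
    (heqb₂ : ∀ τ ∈ Set.Ioo (-1 : ℝ) 1,
      (1 - τ) * deriv b₂ τ
        - (q : ℝ) * ((q : ℝ) + 1) / (2 * (p : ℝ)) * (1 + τ) * b₀ τ
        + (-((q : ℝ) * ((q : ℝ) + 1) / (2 * (p : ℝ))) * (1 - τ) + (p : ℝ) - 1) * b₂ τ = 0) :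
    ∀ τ ∈ Set.Ioo (-1 : ℝ) 1,
      a₀ τ * b₂ τ - a₂ τ * b₀ τ
        = (a₀ 0 * b₂ 0 - a₂ 0 * b₀ 0) * (1 - τ ^ 2) ^ (p - 1) := by
  obtain ⟨n, rfl⟩ : ∃ n, p = n + 1 := ⟨p - 1, by omega⟩
  generalize (q : ℝ) * ((q : ℝ) + 1) / (2 * ((n + 1 : ℕ) : ℝ)) = c at *
  simp only [Nat.add_sub_cancel]
  have hpos : ∀ x ∈ Set.Ioo (-1 : ℝ) 1, 1 - x ^ 2 ≠ 0 := by
    intro x hx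
    have : 0 < (1 - x) * (1 + x) := mul_pos (by linarith [hx.2]) (by linarith [hx.1])
    nlinarith
  have hG : ∀ x ∈ Set.Ioo (-1 : ℝ) 1,
      HasDerivAt (fun t => (a₀ t * b₂ t - a₂ t * b₀ t) / (1 - t ^ 2) ^ n) 0 x := by
    intro x hx
    have hu := hpos x hx
    have hW := ((hda₀ x hx).hasDerivAt.mul (hdb₂ x hx).hasDerivAt).sub
      ((hda₂ x hx).hasDerivAt.mul (hdb₀ x hx).hasDerivAt)
    have hU := (((hasDerivAt_id x).pow 2).const_sub 1).pow n
    have h := hW.div hU (pow_ne_zero n hu)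
    refine h.congr_deriv ?_
    have key : (deriv a₀ x * b₂ x + a₀ x * deriv b₂ x
        - (deriv a₂ x * b₀ x + a₂ x * deriv b₀ x)) * (1 - x ^ 2)
        = -(2 * n * x) * (a₀ x * b₂ x - a₂ x * b₀ x) := by
      have e1 := heqa₀ x hx
      have e2 := heqa₂ x hx
      have e3 := heqb₀ x hx
      have e4 := heqb₂ x hx
      push_cast at e1 e2 e3 e4
      linear_combination (1 - x) * b₂ x * e1 + (1 + x) * a₀ x * e4
        - (1 + x) * b₀ x * e2 - (1 - x) * a₂ x * e3
    rw [div_eq_zero_iff]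
    left
    apply mul_right_cancel₀ hu
    rcases n with _ | m
    · simp at key ⊢
      rcases key with key | key
      · left; linarith
      · exact absurd key hu
    · simp at key ⊢
      rw [pow_succ]
      left
      linear_combination (1 - x ^ 2) ^ m * key
  intro τ hτ
  have h0 : (0 : ℝ) ∈ Set.Ioo (-1 : ℝ) 1 := by constructor <;> norm_num
  have := (convex_Ioo (-1 : ℝ) 1).is_const_of_fderivWithin_eq_zero (𝕜 := ℝ)
    (f := fun t => (a₀ t * b₂ t - a₂ t * b₀ t) / (1 - t ^ 2) ^ n)
    (fun x hx => (hG x hx).differentiableAt.differentiableWithinAt)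
    (fun x hx => by
      rw [fderivWithin_of_isOpen isOpen_Ioo hx]
      have := (hG x hx).hasFDerivAt.fderiv
      rw [this]; ext; simp) hτ h0
  rw [div_eq_iff (pow_ne_zero n (hpos τ hτ))] at this
  simpa using this
end

section
/- Let p ≥ 2 and 1 ≤ q ≤ p−1 be integers and let u₀, u₂ be real polynomials. Let (a₀,a₂) : (−1,1) → ℝ be any differentiable solution of the nonhomogeneous system, with c := q(q+1)/(2p): (1+τ)·a₀′(τ) + (c·(1+τ) − p + 1)·a₀(τ) + c·(1−τ)·a₂(τ) = u₀(τ) and (1−τ)·a₂′(τ) − c·(1+τ)·a₀(τ) + (−c·(1−τ) + p − 1)·a₂(τ) = u₂(τ). Then there exist real polynomials P₀, Q₀, R₀, P₂, Q₂, R₂ such that for all τ ∈ (−1,1): a₀(τ) = P₀(τ) + Q₀(τ)·ln(1−τ) + R₀(τ)·ln(1+τ) and a₂(τ) = P₂(τ) + Q₂(τ)·ln(1−τ) + R₂(τ)·ln(1+τ). -/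
open Polynomial in
lemma exG (p q : ℕ) (hpq : q + 1 ≤ p) : ∃ G : Polynomial ℝ,
    2 * (X * derivative (derivative G)) - X * (X * derivative (derivative G))
      - C (2 * ((p:ℝ) - 1)) * derivative G - 2 * (X * derivative G)
      + C ((q:ℝ) * (q + 1)) * G = 0 ∧ 0 < G.eval 0 ∧ 0 < G.eval 2 := by
  let w : ℕ → ℝ := fun k => ∏ j ∈ Finset.range k,
    (((q:ℝ) * (q + 1) - j * (j + 1)) / (2 * (j + 1) * (p - 1 - j)))
  have hw : ∀ k, w (k+1) = w k * (((q:ℝ) * (q + 1) - k * (k + 1)) / (2 * (k + 1) * (p - 1 - k))) :=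
    fun k => Finset.prod_range_succ _ _
  have hw0 : w 0 = 1 := Finset.prod_range_zero _
  have hbig : ∀ k, q < k → w k = 0 := by
    intro k hk
    refine Finset.prod_eq_zero (Finset.mem_range.2 hk) ?_
    simp
  have hpos : ∀ k, k ≤ q → 0 < w k := by
    intro k hk
    refine Finset.prod_pos fun j hj => ?_
    have hj := Finset.mem_range.1 hj
    have h1 : (j:ℝ) + 1 ≤ q := by exact_mod_cast (by omega : j + 1 ≤ q)
    have h2 : (q:ℝ) + 1 ≤ p := by exact_mod_cast hpq
    have h0 : (0:ℝ) ≤ j := Nat.cast_nonneg j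
    apply div_pos
    · nlinarith
    · apply mul_pos <;> linarith
  have hrec : ∀ k : ℕ, 2 * ((k:ℝ) + 1) * (k + 1 - p) * w (k+1) = (k * (k+1) - q * (q+1)) * w k := by
    intro k
    rcases lt_trichotomy k q with h | h | h
    · have h1 : (k:ℝ) + 1 ≤ q := by exact_mod_cast h
      have h2 : (q:ℝ) + 1 ≤ p := by exact_mod_cast hpq
      have h3 : (p:ℝ) - 1 - k ≠ 0 := by linarith
      have h4 : (k:ℝ) + 1 ≠ 0 := by positivity
      rw [hw]; field_simp; ring
    · subst h; rw [hbig (k+1) (by omega)]; ring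
    · rw [hbig _ h, hbig (k+1) (by omega)]; ring
  let G : ℝ[X] := ∑ k ∈ Finset.range (q+1), C (w k) * X ^ k
  have hG : ∀ n, G.coeff n = w n := by
    intro n
    simp only [G, finsetSum_coeff, coeff_C_mul, coeff_X_pow]
    by_cases h : n < q + 1
    · rw [Finset.sum_eq_single n] <;> simp_all
      intro b _ hb h; exact absurd h.symm hb
    · rw [hbig n (by omega)]
      apply Finset.sum_eq_zero
      intro k hk
      have := Finset.mem_range.1 hk
      rw [if_neg (by omega)]; simp
  refine ⟨G, ?_, ?_, ?_⟩
  · ext n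
    have e2 : (2 : ℝ[X]) = C 2 := (map_ofNat C 2).symm
    rw [e2]
    rcases n with _ | _ | n
    · have := hrec 0
      simp [coeff_derivative, hG] at this ⊢
      linarith
    · have := hrec 1
      simp only [coeff_add, coeff_sub, coeff_C_mul, coeff_X_mul, coeff_X_mul_zero, coeff_derivative, hG, coeff_zero]
      push_cast at this ⊢
      norm_num at this ⊢
      linarith
    · have := hrec (n+2)
      simp only [coeff_add, coeff_sub, coeff_C_mul, coeff_X_mul, coeff_derivative, hG, coeff_zero]
      push_cast at this ⊢
      linear_combination this
  · rw [← coeff_zero_eq_eval_zero, hG, hw0]; exact one_pos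
  · simp only [G, eval_finsetSum, eval_mul, eval_C, eval_pow, eval_X]
    apply Finset.sum_pos
    · intro k hk
      have := hpos k (by have := Finset.mem_range.1 hk; omega)
      positivity
    · simp

lemma exV (p q : ℕ) (hpq : q + 1 ≤ p) : ∃ V V' V'' : Polynomial ℝ,
    Polynomial.derivative V = V' ∧ Polynomial.derivative V' = V'' ∧
    (∀ t : ℝ, (1 - t^2) * V''.eval t - 2 * (p + t) * V'.eval t + q * (q+1) * V.eval t = 0) ∧
    0 < V.eval (-1) ∧ 0 < V.eval 1 := by
  obtain ⟨G, h, h0, h2⟩ := exG p q hpq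
  refine ⟨G.comp (1 + Polynomial.X), _, _, rfl, rfl, ?_, ?_, ?_⟩
  · intro t
    have := congrArg (Polynomial.eval (1 + t)) h
    simp [Polynomial.derivative_comp] at this ⊢
    linear_combination this
  · simpa using h0
  · norm_num; exact h2

open Polynomial in
lemma exPart (n : ℕ) (g : Polynomial ℝ) : ∃ (A : Polynomial ℝ) (α : ℝ),
    X * derivative A - C (n:ℝ) * A + C α * X ^ n = g := by
  induction g using Polynomial.induction_on' with
  | add g h hg hh =>
    obtain ⟨A, α, rfl⟩ := hg
    obtain ⟨B, β, rfl⟩ := hh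
    refine ⟨A + B, α + β, ?_⟩
    simp; ring
  | monomial k a =>
    by_cases h : k = n
    · refine ⟨0, a, ?_⟩
      subst h; simp [C_mul_X_pow_eq_monomial]
    · refine ⟨monomial k (a / (k - n)), 0, ?_⟩
      have : (k:ℝ) - n ≠ 0 := sub_ne_zero.2 (by exact_mod_cast h)
      ext j
      rcases j with _ | j
      · simp [coeff_monomial]
        split_ifs with hk
        · subst hk; simp at this ⊢; field_simp
        · simp
      · simp [coeff_X_mul, coeff_derivative, coeff_monomial]
        split_ifs with hj
        · subst hj; push_cast at this ⊢; field_simp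
        · simp

lemma solve_plus (n : ℕ) (g : Polynomial ℝ) (N N' : ℝ → ℝ)
    (hN : ∀ t ∈ Set.Ioo (-1:ℝ) 1, HasDerivAt N (N' t) t)
    (h : ∀ t ∈ Set.Ioo (-1:ℝ) 1, (1 + t) * N' t - n * N t = g.eval t) :
    ∃ A B : Polynomial ℝ, ∀ t ∈ Set.Ioo (-1:ℝ) 1,
      N t = A.eval t + B.eval t * Real.log (1 + t) := by
  obtain ⟨A, α, hA⟩ := exPart n (g.comp (Polynomial.X - 1))
  have hA' : ∀ t : ℝ, (1 + t) * (Polynomial.derivative A).eval (1 + t) - n * A.eval (1 + t)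
      + α * (1 + t)^n = g.eval t := by
    intro t
    have := congrArg (Polynomial.eval (1 + t)) hA
    simpa using this
  let F : ℝ → ℝ := fun t => (N t - A.eval (1 + t)) / (1 + t)^n - α * Real.log (1 + t)
  have hF : ∀ t ∈ Set.Ioo (-1:ℝ) 1, HasDerivAt F 0 t := by
    intro t ht
    have hp : 0 < 1 + t := by linarith [ht.1]
    have h1 : HasDerivAt (fun t : ℝ => 1 + t) 1 t := (hasDerivAt_id t).const_add 1
    have h2 := (A.hasDerivAt (1 + t)).comp t h1
    have h3 := (((hN t ht).sub h2).div (h1.pow n) (pow_pos hp n).ne').sub ((h1.log hp.ne').const_mul α)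
    refine h3.congr_deriv ?_
    have e1 := h t ht
    have e2 := hA' t
    rcases n with _ | n
    · simp at e1 e2 ⊢
      field_simp
      linarith
    · simp only [Nat.add_sub_cancel, Function.comp, Pi.sub_apply, Pi.pow_apply]
      field_simp
      rw [← e2] at e1
      push_cast at e1 ⊢
      linear_combination (1+t)^(n+1) * e1
  have hc : ∀ t ∈ Set.Ioo (-1:ℝ) 1, F t = F 0 := by
    intro t ht
    refine (convex_Ioo (-1:ℝ) 1).is_const_of_fderivWithin_eq_zero (𝕜 := ℝ) (f := F) ?_ ?_ ht (by norm_num)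
    · intro x hx; exact (hF x hx).differentiableAt.differentiableWithinAt
    · intro x hx
      rw [fderivWithin_of_isOpen isOpen_Ioo hx]
      have := (hF x hx).hasFDerivAt.fderiv
      rw [this]; ext; simp
  refine ⟨A.comp (1 + Polynomial.X) + Polynomial.C (F 0) * (1 + Polynomial.X)^n,
    Polynomial.C α * (1 + Polynomial.X)^n, fun t ht => ?_⟩
  have hp : 0 < 1 + t := by linarith [ht.1]
  have := hc t ht
  rw [← this]
  simp [F]
  field_simp
  ring

lemma solve_minus (n : ℕ) (g : Polynomial ℝ) (N N' : ℝ → ℝ)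
    (hN : ∀ t ∈ Set.Ioo (-1:ℝ) 1, HasDerivAt N (N' t) t)
    (h : ∀ t ∈ Set.Ioo (-1:ℝ) 1, (1 - t) * N' t + n * N t = g.eval t) :
    ∃ A B : Polynomial ℝ, ∀ t ∈ Set.Ioo (-1:ℝ) 1,
      N t = A.eval t + B.eval t * Real.log (1 - t) := by
  have hm : ∀ t ∈ Set.Ioo (-1:ℝ) 1, -t ∈ Set.Ioo (-1:ℝ) 1 := by
    intro t ht; exact ⟨by linarith [ht.2], by linarith [ht.1]⟩
  obtain ⟨A, B, hAB⟩ := solve_plus n (-(g.comp (-Polynomial.X))) (fun t => N (-t)) (fun t => -N' (-t))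
    (fun t ht => by
      have := (hN (-t) (hm t ht)).comp t (hasDerivAt_neg t)
      simpa [Function.comp_def] using this)
    (fun t ht => by
      have := h (-t) (hm t ht)
      simp
      linarith)
  refine ⟨A.comp (-Polynomial.X), B.comp (-Polynomial.X), fun t ht => ?_⟩
  have := hAB (-t) (hm t ht)
  simpa [sub_eq_add_neg] using this

/-- Solutions to the nonhomogeneous reduced transport system with polynomial
right-hand sides lie in the ring generated by polynomials in `τ` and the
functions `ln(1-τ)` and `ln(1+τ)`. -/
theorem nonhomogeneous_solutions_polylog (p q : ℕ) (hp : 2 ≤ p) (hq₁ : 1 ≤ q)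
    (hq₂ : q ≤ p - 1) (u₀ u₂ : Polynomial ℝ) (a₀ a₂ : ℝ → ℝ)
    (hd₀ : ∀ τ ∈ Set.Ioo (-1 : ℝ) 1, DifferentiableAt ℝ a₀ τ)
    (hd₂ : ∀ τ ∈ Set.Ioo (-1 : ℝ) 1, DifferentiableAt ℝ a₂ τ)
    (heq₀ : ∀ τ ∈ Set.Ioo (-1 : ℝ) 1,
      (1 + τ) * deriv a₀ τ
        + ((q : ℝ) * ((q : ℝ) + 1) / (2 * (p : ℝ)) * (1 + τ) - (p : ℝ) + 1) * a₀ τ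
        + (q : ℝ) * ((q : ℝ) + 1) / (2 * (p : ℝ)) * (1 - τ) * a₂ τ = u₀.eval τ)
    (heq₂ : ∀ τ ∈ Set.Ioo (-1 : ℝ) 1,
      (1 - τ) * deriv a₂ τ
        - (q : ℝ) * ((q : ℝ) + 1) / (2 * (p : ℝ)) * (1 + τ) * a₀ τ
        + (-((q : ℝ) * ((q : ℝ) + 1) / (2 * (p : ℝ))) * (1 - τ) + (p : ℝ) - 1) * a₂ τ
          = u₂.eval τ) :
    ∃ P₀ Q₀ R₀ P₂ Q₂ R₂ : Polynomial ℝ,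
      ∀ τ ∈ Set.Ioo (-1 : ℝ) 1,
        a₀ τ = P₀.eval τ + Q₀.eval τ * Real.log (1 - τ) + R₀.eval τ * Real.log (1 + τ) ∧
        a₂ τ = P₂.eval τ + Q₂.eval τ * Real.log (1 - τ) + R₂.eval τ * Real.log (1 + τ) := by
  have hpq : q + 1 ≤ p := by omega
  have hp0 : (p:ℝ) ≠ 0 := by positivity
  obtain ⟨V, V', V'', hV', hV'', hode, hVm, hVp⟩ := exV p q hpq
  have dV : ∀ t : ℝ, HasDerivAt (fun t => V.eval t) (V'.eval t) t := fun t => hV' ▸ V.hasDerivAt t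
  have dV' : ∀ t : ℝ, HasDerivAt (fun t => V'.eval t) (V''.eval t) t := fun t => hV'' ▸ V'.hasDerivAt t
  -- reflected solution
  obtain ⟨U, hU⟩ : ∃ U : Polynomial ℝ, U = V.comp (-Polynomial.X) := ⟨_, rfl⟩
  obtain ⟨U', hU'⟩ : ∃ U' : Polynomial ℝ, U' = -V'.comp (-Polynomial.X) := ⟨_, rfl⟩
  obtain ⟨U'', hU''⟩ : ∃ U'' : Polynomial ℝ, U'' = V''.comp (-Polynomial.X) := ⟨_, rfl⟩
  have hdU : Polynomial.derivative U = U' := by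
    rw [hU, hU', Polynomial.derivative_comp, hV']; simp
  have hdU' : Polynomial.derivative U' = U'' := by
    rw [hU', hU'', Polynomial.derivative_neg, Polynomial.derivative_comp, hV'']; simp
  have dU : ∀ t : ℝ, HasDerivAt (fun t => U.eval t) (U'.eval t) t := fun t => hdU ▸ U.hasDerivAt t
  have dU' : ∀ t : ℝ, HasDerivAt (fun t => U'.eval t) (U''.eval t) t := fun t => hdU' ▸ U'.hasDerivAt t
  have hodeU : ∀ t : ℝ, (1 - t^2) * U''.eval t + 2 * (p - t) * U'.eval t + q * (q+1) * U.eval t = 0 := by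
    intro t
    have := hode (-t)
    simp [hU, hU', hU''] at this ⊢
    linarith
  -- Wronskian constant
  obtain ⟨K, hK0, hK⟩ : ∃ K : ℝ, K ≠ 0 ∧ ∀ t : ℝ, 2 * p * V.eval t * U.eval t
      + (1 - t^2) * (V.eval t * U'.eval t - V'.eval t * U.eval t) = K := by
    have hd : ∀ t : ℝ, HasDerivAt (fun t : ℝ => 2 * p * V.eval t * U.eval t
      + (1 - t^2) * (V.eval t * U'.eval t - V'.eval t * U.eval t)) 0 t := by
      intro t
      have := ((((dV t).const_mul (2 * (p:ℝ))).mul (dU t))).add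
        ((((hasDerivAt_id t).pow 2).const_sub 1).mul
          (((dV t).mul (dU' t)).sub ((dV' t).mul (dU t))))
      refine this.congr_deriv ?_
      simp
      linear_combination V.eval t * hodeU t - U.eval t * hode t
    refine ⟨_, ?_, fun t => is_const_of_deriv_eq_zero (fun t => (hd t).differentiableAt)
      (fun t => (hd t).deriv) t (-1)⟩
    have : U.eval (-1) = V.eval 1 := by simp [hU]
    rw [this]
    have : (0:ℝ) < p := by positivity
    norm_num
    exact ⟨⟨by omega, hVm.ne'⟩, hVp.ne'⟩
  -- the unknowns
  obtain ⟨u, hu⟩ : ∃ u : Polynomial ℝ, u = u₀ + u₂ := ⟨_, rfl⟩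
  let S : ℝ → ℝ := fun t => (1 + t) * a₀ t + (1 - t) * a₂ t
  let T : ℝ → ℝ := fun t => p * (a₀ t - a₂ t) + u.eval t
  let T' : ℝ → ℝ := fun t => p * (deriv a₀ t - deriv a₂ t) + (Polynomial.derivative u).eval t
  have hS : ∀ t ∈ Set.Ioo (-1:ℝ) 1, HasDerivAt S (T t) t := by
    intro t ht
    have := (((hasDerivAt_id t).const_add 1).mul (hd₀ t ht).hasDerivAt).add
      (((hasDerivAt_id t).const_sub 1).mul (hd₂ t ht).hasDerivAt)
    refine this.congr_deriv ?_
    have e0 := heq₀ t ht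
    have e2 := heq₂ t ht
    simp [T, hu]
    linear_combination e0 + e2
  have hT : ∀ t ∈ Set.Ioo (-1:ℝ) 1, HasDerivAt T (T' t) t := by
    intro t ht
    exact (((hd₀ t ht).hasDerivAt.sub (hd₂ t ht).hasDerivAt).const_mul (p:ℝ)).add (u.hasDerivAt t)
  obtain ⟨f, hf⟩ : ∃ f : Polynomial ℝ, f = (1 - Polynomial.X^2) * Polynomial.derivative u
      + Polynomial.C ((p:ℝ) - 2) * Polynomial.X * u + Polynomial.C (p:ℝ) * (u₀ - u₂) := ⟨_, rfl⟩
  have hST : ∀ t ∈ Set.Ioo (-1:ℝ) 1, (1 - t^2) * T' t + 2 * (p - 1) * t * T t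
      + (q * (q + 1) - p * (p - 1)) * S t = f.eval t := by
    intro t ht
    have e0 := heq₀ t ht
    have e2 := heq₂ t ht
    obtain ⟨c, hc⟩ : ∃ c : ℝ, c = (q : ℝ) * ((q : ℝ) + 1) / (2 * (p : ℝ)) := ⟨_, rfl⟩
    have hc' : (q : ℝ) * ((q : ℝ) + 1) = 2 * p * c := by rw [hc]; field_simp
    rw [← hc] at e0 e2
    rw [hc']
    simp [S, T, T', hf, hu]
    linear_combination (1 - t) * p * e0 - (1 + t) * p * e2
  have hcast : ((p - 1 : ℕ) : ℝ) = p - 1 := by push_cast [Nat.cast_sub (by omega : 1 ≤ p)]; rfl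
  let N₁ : ℝ → ℝ := fun t => (1 - t) * V.eval t * T t - ((1 - t) * V'.eval t - p * V.eval t) * S t
  let N₂ : ℝ → ℝ := fun t => (1 + t) * U.eval t * T t - ((1 + t) * U'.eval t + p * U.eval t) * S t
  obtain ⟨A, B, hAB⟩ := solve_plus (p - 1) (V * f) N₁ _
    (fun t ht => ((((((hasDerivAt_id t).const_sub 1).mul (dV t))).mul (hT t ht)).sub
      (((((hasDerivAt_id t).const_sub 1).mul (dV' t)).sub ((dV t).const_mul (p:ℝ))).mul (hS t ht))))
    (fun t ht => by
      have e := hST t ht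
      rw [Polynomial.eval_mul, ← e, hcast]
      simp [N₁]
      linear_combination (-(1 - t) * 0 - S t) * hode t)
  obtain ⟨A₂, B₂, hAB₂⟩ := solve_minus (p - 1) (U * f) N₂ _
    (fun t ht => ((((((hasDerivAt_id t).const_add 1).mul (dU t))).mul (hT t ht)).sub
      (((((hasDerivAt_id t).const_add 1).mul (dU' t)).add ((dU t).const_mul (p:ℝ))).mul (hS t ht))))
    (fun t ht => by
      have e := hST t ht
      rw [Polynomial.eval_mul, ← e, hcast]
      simp [N₂]
      linear_combination (- S t) * hodeU t)
  have hSK : ∀ t, K * S t = (1 + t) * U.eval t * N₁ t - (1 - t) * V.eval t * N₂ t := by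
    intro t
    rw [← hK t]; simp only [N₁, N₂]; ring
  have hTK : ∀ t, K * T t = ((1 + t) * U'.eval t + p * U.eval t) * N₁ t
      - ((1 - t) * V'.eval t - p * V.eval t) * N₂ t := by
    intro t
    rw [← hK t]; simp only [N₁, N₂]; ring
  -- coefficients of N₁ and N₂ in a₀ and a₂
  obtain ⟨s₁, hs₁⟩ : ∃ s : Polynomial ℝ, s = (1 + Polynomial.X) * U := ⟨_, rfl⟩
  obtain ⟨s₂, hs₂⟩ : ∃ s : Polynomial ℝ, s = -((1 - Polynomial.X) * V) := ⟨_, rfl⟩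
  obtain ⟨t₁, ht₁⟩ : ∃ s : Polynomial ℝ, s = (1 + Polynomial.X) * U' + Polynomial.C (p:ℝ) * U := ⟨_, rfl⟩
  obtain ⟨t₂, ht₂⟩ : ∃ s : Polynomial ℝ, s = -((1 - Polynomial.X) * V' - Polynomial.C (p:ℝ) * V) := ⟨_, rfl⟩
  let k : Polynomial ℝ := Polynomial.C (1 / (2 * K * p))
  let m₁ : Polynomial ℝ := k * (Polynomial.C (p:ℝ) * s₁ + (1 - Polynomial.X) * t₁)
  let m₂ : Polynomial ℝ := k * (Polynomial.C (p:ℝ) * s₂ + (1 - Polynomial.X) * t₂)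
  let n₁ : Polynomial ℝ := k * (Polynomial.C (p:ℝ) * s₁ - (1 + Polynomial.X) * t₁)
  let n₂ : Polynomial ℝ := k * (Polynomial.C (p:ℝ) * s₂ - (1 + Polynomial.X) * t₂)
  refine ⟨m₁ * A + m₂ * A₂ - Polynomial.C (1 / (2 * (p:ℝ))) * (1 - Polynomial.X) * u, m₂ * B₂, m₁ * B,
    n₁ * A + n₂ * A₂ + Polynomial.C (1 / (2 * (p:ℝ))) * (1 + Polynomial.X) * u, n₂ * B₂, n₁ * B,
    fun t ht => ?_⟩
  have eS := hSK t
  have eT := hTK t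
  rw [hAB t ht, hAB₂ t ht] at eS eT
  simp only [S, T] at eS eT
  constructor
  · simp only [m₁, m₂, k, hs₁, hs₂, ht₁, ht₂, Polynomial.eval_add, Polynomial.eval_sub, Polynomial.eval_mul, Polynomial.eval_C, Polynomial.eval_X, Polynomial.eval_one, Polynomial.eval_neg]
    field_simp
    linear_combination p * eS + (1 - t) * eT
  · simp only [n₁, n₂, k, hs₁, hs₂, ht₁, ht₂, Polynomial.eval_add, Polynomial.eval_sub, Polynomial.eval_mul, Polynomial.eval_C, Polynomial.eval_X, Polynomial.eval_one, Polynomial.eval_neg]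
    field_simp
    linear_combination p * eS - (1 + t) * eT
end

section
/- Let p ≥ 1 be an integer and m a nonzero real number. Define A₀(τ) = (1−τ)^{p+2} · Σ_{m′=0}^{p−1} C(p−1,m′) · (1/(p+2+m′)) · ((τ−1)/2)^{m′}, and let A₂ be the unique polynomial such that (A₀,A₂) solves on (−1,1) the homogeneous system (1+τ)·A₀′ + ((p/2)(1+τ) − p)·A₀ + (p/2)(1−τ)·A₂ = 0, (1−τ)·A₂′ − (p/2)(1+τ)·A₀ + (−(p/2)(1−τ) + p)·A₂ = 0. Define the polynomials g₀(τ) = (mτ/12)(1+τ)[ (4p²+9p)τ⁵ + (8p²+10p−12)τ⁴ − (16p²+33p−4)τ³ − (56p²+112p+8)τ² − (48p²+126p+72)τ − (24p+48) ] and g₂(τ) = −(mτ²/12)(1+τ)[ (4p+9)τ⁴ − (4p+6)τ³ − (28p+57)τ² + (16p+24)τ + (24p+42) ]. Then, with c := p(p+1)/(2(p+2)), every differentiable solution (a₀,a₂) : (−1,1) → ℝ of the system (1+τ)·a₀′ + (c(1+τ) − p − 1)·a₀ + c(1−τ)·a₂ = ( g₀(τ)·A₀(τ) + g₂(τ)·A₂(τ)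 )/(1+τ)² and (1−τ)·a₂′ − c(1+τ)·a₀ + (−c(1−τ) + p + 1)·a₂ = ( g₀(−τ)·A₀(τ) + g₂(−τ)·A₂(τ) )/(1−τ)² contains logarithmic divergences at τ = 1: at least one of a₀, a₂ does not extend to a C^∞ function on (−1,1]. -/
open Finset

/-- The particular order `p+1` homogeneous solution component
`A₀ = 2^(p+2)((1-τ)/2)^(p+2) P_{p-1}^{(p+2,-p)}(τ)`, written out explicitly. -/
noncomputable def A₀ (p : ℕ) : ℝ → ℝ := fun τ =>
  (1 - τ) ^ (p + 2) * ∑ m ∈ Finset.range p,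
    (Nat.choose (p - 1) m : ℝ) * (1 / ((p : ℝ) + 2 + m)) * ((τ - 1) / 2) ^ m

/-- Background coupling polynomial `g₀` of the order `p+2` Maxwell transport
equations on the Schwarzschild spacetime of mass `m`. -/
noncomputable def g₀ (m : ℝ) (p : ℕ) : ℝ → ℝ := fun τ =>
  (m * τ / 12) * (1 + τ) *
    ((4 * (p : ℝ) ^ 2 + 9 * (p : ℝ)) * τ ^ 5 + (8 * (p : ℝ) ^ 2 + 10 * (p : ℝ) - 12) * τ ^ 4
      - (16 * (p : ℝ) ^ 2 + 33 * (p : ℝ) - 4) * τ ^ 3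
      - (56 * (p : ℝ) ^ 2 + 112 * (p : ℝ) + 8) * τ ^ 2
      - (48 * (p : ℝ) ^ 2 + 126 * (p : ℝ) + 72) * τ - (24 * (p : ℝ) + 48))

/-- Background coupling polynomial `g₂` of the order `p+2` Maxwell transport
equations on the Schwarzschild spacetime of mass `m`. -/
noncomputable def g₂ (m : ℝ) (p : ℕ) : ℝ → ℝ := fun τ =>
  -(m * τ ^ 2 / 12) * (1 + τ) *
    ((4 * (p : ℝ) + 9) * τ ^ 4 - (4 * (p : ℝ) + 6) * τ ^ 3 - (28 * (p : ℝ) + 57) * τ ^ 2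
      + (16 * (p : ℝ) + 24) * τ + (24 * (p : ℝ) + 42))

lemma smooth_key (n : ℕ) : ∀ V S : ℝ → ℝ,
    ContDiffOn ℝ (⊤ : ℕ∞) V (Set.Ioc (-1 : ℝ) 1) →
    ContDiffOn ℝ (⊤ : ℕ∞) S (Set.Ioc (-1 : ℝ) 1) →
    (∀ τ ∈ Set.Ioo (-1 : ℝ) 1, (1 - τ) * deriv V τ + (n : ℝ) * V τ = (1 - τ) ^ n * S τ) →
    S 1 = 0 := by
  have hu : UniqueDiffOn ℝ (Set.Ioc (-1 : ℝ) 1) := uniqueDiffOn_Ioc _ _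
  have hnh : ∀ τ ∈ Set.Ioo (-1 : ℝ) 1, Set.Ioc (-1 : ℝ) 1 ∈ nhds τ := fun τ h =>
    Filter.mem_of_superset (isOpen_Ioo.mem_nhds h) Set.Ioo_subset_Ioc_self
  have h1 : (1 : ℝ) ∈ Set.Ioc (-1 : ℝ) 1 := by norm_num
  have hdw : ∀ V : ℝ → ℝ, ContDiffOn ℝ (⊤ : ℕ∞) V (Set.Ioc (-1 : ℝ) 1) →
      ContDiffOn ℝ (⊤ : ℕ∞) (derivWithin V (Set.Ioc (-1 : ℝ) 1)) (Set.Ioc (-1 : ℝ) 1) :=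
    fun V hV => hV.derivWithin hu (by simp)
  have hda : ∀ V : ℝ → ℝ, ContDiffOn ℝ (⊤ : ℕ∞) V (Set.Ioc (-1 : ℝ) 1) →
      ∀ τ ∈ Set.Ioo (-1 : ℝ) 1,
        HasDerivAt V (derivWithin V (Set.Ioc (-1 : ℝ) 1) τ) τ := by
    intro V hV τ hτ
    rw [derivWithin_of_mem_nhds (hnh τ hτ)]
    exact ((hV.contDiffAt (hnh τ hτ)).differentiableAt (by simp)).hasDerivAt
  induction n with
  | zero =>
    intro V S hV hS h
    have hc : ContinuousOn (fun τ => (1 - τ) * derivWithin V (Set.Ioc (-1 : ℝ) 1) τ - S τ)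
        (Set.Ioc (-1 : ℝ) 1) := by
      have := (hdw V hV).continuousOn
      have := hS.continuousOn
      fun_prop
    have ht := ((hc 1 h1).mono (Set.Ioo_subset_Ioc_self)).tendsto
    have hne : (nhdsWithin (1 : ℝ) (Set.Ioo (-1) 1)).NeBot := by
      rw [← mem_closure_iff_nhdsWithin_neBot, closure_Ioo (by norm_num)]; norm_num
    have ht0 : Filter.Tendsto
        (fun τ => (1 - τ) * derivWithin V (Set.Ioc (-1 : ℝ) 1) τ - S τ)
        (nhdsWithin (1 : ℝ) (Set.Ioo (-1) 1)) (nhds 0) := by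
      refine tendsto_const_nhds.congr' ?_
      filter_upwards [self_mem_nhdsWithin] with τ hτ
      have := h τ hτ
      rw [(hda V hV τ hτ).deriv] at this
      simp at this
      linarith
    have := tendsto_nhds_unique ht ht0
    simpa using this
  | succ n ih =>
    intro V S hV hS h
    have := ih (derivWithin V (Set.Ioc (-1 : ℝ) 1))
      (fun τ => -((n : ℝ) + 1) * S τ + (1 - τ) * derivWithin S (Set.Ioc (-1 : ℝ) 1) τ)
      (hdw V hV) (by
        have := hdw S hS
        fun_prop) (by
        intro τ hτ
        have hV1 := hda V hV τ hτ
        have hV2 := hda _ (hdw V hV) τ hτ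
        have hS1 := hda S hS τ hτ
        have hx : HasDerivAt (fun t : ℝ => 1 - t) (-1) τ := by
          simpa using (hasDerivAt_id τ).const_sub 1
        have hL := (hx.mul hV2).add (hV1.const_mul ((n : ℝ) + 1))
        have hR := (hx.pow (n + 1)).mul hS1
        have he := hL.unique (hR.congr_of_eventuallyEq (by
          filter_upwards [isOpen_Ioo.mem_nhds hτ] with t ht
          have := h t ht
          rw [(hda V hV t ht).deriv] at this
          push_cast at this
          simpa using this))
        rw [hV2.deriv]
        simp at he
        rw [pow_succ] at he
        linear_combination he)
    simp at this
    rcases this with h | h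
    · exfalso
      have : (0 : ℝ) ≤ n := Nat.cast_nonneg n
      linarith
    · exact h

/-- the sum in A₀ -/
noncomputable def BB (p : ℕ) : ℝ → ℝ := fun τ => ∑ m ∈ Finset.range p,
    (Nat.choose (p - 1) m : ℝ) * (1 / ((p : ℝ) + 2 + m)) * ((τ - 1) / 2) ^ m

lemma BB_smooth (p : ℕ) : ContDiff ℝ (⊤ : ℕ∞) (BB p) := by
  unfold BB
  fun_prop

lemma BB_one (k : ℕ) : BB (k + 1) 1 = 1 / ((k : ℝ) + 3) := by
  unfold BB
  rw [Finset.sum_eq_single 0]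
  · simp; ring
  · intro b _ hb
    simp [hb]
  · simp

lemma A₀_deriv (k : ℕ) (τ : ℝ) :
    deriv (A₀ (k + 1)) τ = -(1 - τ) ^ (k + 2) * ((1 + τ) / 2) ^ k := by
  have hx : HasDerivAt (fun t : ℝ => 1 - t) (-1) τ := by
    simpa using (hasDerivAt_id τ).const_sub 1
  have he : A₀ (k + 1) = fun t => ∑ m ∈ Finset.range (k + 1),
      ((Nat.choose k m : ℝ) * (-1 / 2) ^ m * (1 / ((k : ℝ) + 3 + m))) * (1 - t) ^ (k + 3 + m) := by
    funext t
    unfold A₀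
    rw [Finset.mul_sum]
    refine Finset.sum_congr rfl fun m _ => ?_
    have : ((t - 1) / 2) ^ m = (-1 / 2) ^ m * (1 - t) ^ m := by
      rw [← mul_pow]; congr 1; ring
    rw [this]
    push_cast
    try simp only [Nat.add_sub_cancel]
    rw [show (k : ℝ) + 1 + 2 + m = k + 3 + m by ring]
    ring
  have hd : HasDerivAt (A₀ (k + 1)) (∑ m ∈ Finset.range (k + 1),
      ((Nat.choose k m : ℝ) * (-1 / 2) ^ m * (1 / ((k : ℝ) + 3 + m))) *
        (((k + 3 + m : ℕ) : ℝ) * (1 - τ) ^ (k + 3 + m - 1) * (-1))) τ := by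
    rw [he]
    exact HasDerivAt.fun_sum fun m _ => (hx.fun_pow (k + 3 + m)).const_mul _
  rw [hd.deriv, show (1 + τ) / 2 = (-1 / 2) * (1 - τ) + 1 by ring, add_pow, Finset.mul_sum]
  refine Finset.sum_congr rfl fun m _ => ?_
  rw [show k + 3 + m - 1 = k + 2 + m by omega, mul_pow, pow_add (1 - τ) (k + 2) m]
  have : (k : ℝ) + 3 + m ≠ 0 := by positivity
  push_cast
  field_simp
  try ring

lemma A₂_eq (k : ℕ) (τ : ℝ) (h1 : τ < 1) (z : ℝ)
    (h : (1 + τ) * deriv (A₀ (k + 1)) τ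
      + (((k + 1 : ℕ) : ℝ) / 2 * (1 + τ) - ((k + 1 : ℕ) : ℝ)) * A₀ (k + 1) τ
          + ((k + 1 : ℕ) : ℝ) / 2 * (1 - τ) * z = 0) :
    z = (1 - τ) ^ (k + 3) * BB (k + 1) τ
      + 4 / ((k + 1) * 2 ^ (k + 1)) * (1 - τ) ^ (k + 1) * (1 + τ) ^ (k + 1) := by
  rw [A₀_deriv] at h
  have hA : A₀ (k + 1) τ = (1 - τ) ^ (k + 3) * BB (k + 1) τ := rfl
  rw [hA] at h
  generalize BB (k + 1) τ = B at *
  have hx : (1 - τ) ≠ 0 := by linarith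
  have hk : (k : ℝ) + 1 ≠ 0 := by positivity
  push_cast at h
  rw [div_pow] at h
  have h2 : (2 : ℝ) ^ k ≠ 0 := by positivity
  field_simp at h ⊢
  apply mul_left_cancel₀ hx
  have e : (1 + τ) ^ (k + 1) = (1 + τ) ^ k * (1 + τ) := pow_succ _ _
  have e2 : (1 - τ) ^ (k + 3) = (1 - τ) ^ k * (1 - τ) ^ 3 := pow_add _ _ _
  have e3 : (1 - τ) ^ (k + 2) = (1 - τ) ^ k * (1 - τ) ^ 2 := pow_add _ _ _
  have e4 : (1 - τ) ^ (k + 1) = (1 - τ) ^ k * (1 - τ) := pow_succ _ _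
  have e5 : (2 : ℝ) ^ (k + 1) = 2 ^ k * 2 := pow_succ _ _
  simp only [e, e2, e3, e4, e5] at h ⊢
  linear_combination 2 * h

lemma wronsk (P x a b a' b' n1 n2 : ℝ) (hP : P + 2 ≠ 0)
    (h1 : (2 - x) * a' + (P * (P + 1) / (2 * (P + 2)) * (2 - x) - P - 1) * a
        + P * (P + 1) / (2 * (P + 2)) * x * b = n1)
    (h2 : x * b' - P * (P + 1) / (2 * (P + 2)) * (2 - x) * a
        + (-(P * (P + 1) / (2 * (P + 2))) * x + P + 1) * b = n2) :
    x * (2 - x) * (a' * (P - (P + 1) * x) + a * (P + 1)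
        - (b' * ((P + 2) - (P + 1) * x) + b * (P + 1)))
      + 2 * (P + 1) * (1 - x) * (a * (P - (P + 1) * x) - b * ((P + 2) - (P + 1) * x))
    = x * (P - (P + 1) * x) * n1 - (2 - x) * ((P + 2) - (P + 1) * x) * n2 := by
  subst h1 h2
  field_simp
  ring

noncomputable def gt0 (m P τ : ℝ) : ℝ := (m * τ / 12) *
    ((4 * P ^ 2 + 9 * P) * τ ^ 5 + (8 * P ^ 2 + 10 * P - 12) * τ ^ 4
      - (16 * P ^ 2 + 33 * P - 4) * τ ^ 3
      - (56 * P ^ 2 + 112 * P + 8) * τ ^ 2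
      - (48 * P ^ 2 + 126 * P + 72) * τ - (24 * P + 48))

noncomputable def gt2 (m P τ : ℝ) : ℝ := -(m * τ ^ 2 / 12) *
    ((4 * P + 9) * τ ^ 4 - (4 * P + 6) * τ ^ 3 - (28 * P + 57) * τ ^ 2
      + (16 * P + 24) * τ + (24 * P + 42))

/-- second order Taylor remainder of gt2 (-τ) -/
noncomputable def gE (m P τ : ℝ) : ℝ := -(m / 12) *
    (-(92 * P + 177) + (8 * P + 12) * (1 - τ) + (52 * P + 108) * (1 - τ) ^ 2
      - (28 * P + 60) * (1 - τ) ^ 3 + (4 * P + 9) * (1 - τ) ^ 4)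

lemma gE_spec (m P τ : ℝ) : gt2 m P (-τ) =
    m * (P + 2) - m / 12 * (68 * P + 132) * (1 - τ) + (1 - τ) ^ 2 * gE m P τ := by
  unfold gt2 gE
  ring

noncomputable def h0 (m P : ℝ) : ℝ := m * (P + 2) ^ 2 / 2
noncomputable def h1 (m P : ℝ) : ℝ :=
  (-(P + 2) * (m / 12 * (68 * P + 132)) - (P + 1) * (m * (P + 2)) + h0 m P) / 2

noncomputable def Hn (m P τ : ℝ) : ℝ :=
  ((P + 2) - (P + 1) * (1 - τ)) * gE m P τ + (P + 1) * (m / 12 * (68 * P + 132)) + h1 m P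

lemma Hn_spec (m P τ : ℝ) : ((P + 2) - (P + 1) * (1 - τ)) * gt2 m P (-τ) =
    (h0 m P + h1 m P * (1 - τ)) * (1 + τ) + (1 - τ) ^ 2 * Hn m P τ := by
  rw [gE_spec]
  unfold Hn h1 h0
  ring

noncomputable def SS (m : ℝ) (k : ℕ) (τ : ℝ) : ℝ :=
  (((k : ℝ) + 1) - ((k : ℝ) + 1 + 1) * (1 - τ)) *
    (gt0 m (k + 1) τ * ((1 - τ) ^ 2 * BB (k + 1) τ) + gt2 m (k + 1) τ *
      ((1 - τ) ^ 2 * BB (k + 1) τ + 4 / ((k + 1) * 2 ^ (k + 1)) * (1 + τ) ^ (k + 1)))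
      / (1 + τ) ^ (k + 4)
  - (((k : ℝ) + 1 + 2) - ((k : ℝ) + 1 + 1) * (1 - τ)) *
     (gt0 m (k + 1) (-τ) + gt2 m (k + 1) (-τ)) * BB (k + 1) τ / (1 + τ) ^ (k + 2)
  - 4 / ((k + 1) * 2 ^ (k + 1)) * Hn m (k + 1) τ / (1 + τ)

lemma SS_smooth (m : ℝ) (k : ℕ) :
    ContDiffOn ℝ (⊤ : ℕ∞) (SS m k) (Set.Ioc (-1 : ℝ) 1) := by
  have hB := (BB_smooth (k + 1)).contDiffOn (s := Set.Ioc (-1 : ℝ) 1)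
  have hy : ∀ (n : ℕ), ∀ τ ∈ Set.Ioc (-1 : ℝ) 1, (1 + τ) ^ n ≠ 0 := by
    intro n τ hτ
    have : 0 < 1 + τ := by linarith [hτ.1]
    positivity
  have hy1 : ∀ τ ∈ Set.Ioc (-1 : ℝ) 1, (1 + τ) ≠ 0 := by
    intro τ hτ
    have : 0 < 1 + τ := by linarith [hτ.1]
    positivity
  unfold SS gt0 gt2 Hn gE
  refine (ContDiffOn.sub (ContDiffOn.sub (ContDiffOn.div ?_ ?_ (hy _)) (ContDiffOn.div ?_ ?_ (hy _)))
    (ContDiffOn.div ?_ ?_ hy1))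
  all_goals fun_prop

lemma SS_one (m : ℝ) (hm : m ≠ 0) (k : ℕ) : SS m k 1 ≠ 0 := by
  have h : SS m k 1 = -m / (2 ^ (k + 1) * 6 * (k + 1)) *
      (-3 * ((k : ℝ) + 1) ^ 3 + 123 * ((k : ℝ) + 1) ^ 2 + 430 * ((k : ℝ) + 1) + 354) := by
    unfold SS
    rw [BB_one]
    unfold gt0 gt2 Hn h1 h0 gE
    have : (1 + 1 : ℝ) = 2 := by norm_num
    simp only [this, pow_add]
    field_simp
    ring
  rw [h]
  have hk : (k : ℝ) + 1 ≠ 0 := by positivity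
  refine mul_ne_zero (div_ne_zero (neg_ne_zero.2 hm) (by positivity)) ?_
  rcases Nat.lt_or_ge k 44 with h | h
  · have h' : (k : ℝ) ≤ 43 := by exact_mod_cast Nat.le_of_lt_succ h
    have h0 : (0 : ℝ) ≤ k := Nat.cast_nonneg k
    apply ne_of_gt
    set q : ℝ := (k : ℝ) + 1 with hq
    have : 0 ≤ (44 - q) * q := mul_nonneg (by linarith) (by linarith)
    nlinarith [mul_nonneg this (show 0 ≤ q by linarith)]
  · have h' : (44 : ℝ) ≤ k := by exact_mod_cast h
    apply ne_of_lt
    set q : ℝ := (k : ℝ) + 1 with hq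
    have : 0 ≤ (q - 45) * q := mul_nonneg (by linarith) (by linarith)
    nlinarith [mul_nonneg this (show 0 ≤ q by linarith)]

lemma rhs_alg (x y κ B u v w z h0 h1 H b0 b2 : ℝ) (k : ℕ) (hx : x ≠ 0) (hy : y ≠ 0)
    (hH : b0 * z = (h0 + h1 * x) * y + x ^ 2 * H) :
    x * b2 * ((y * u * (x ^ (k + 3) * B)
        + y * v * (x ^ (k + 3) * B + κ * x ^ (k + 1) * y ^ (k + 1))) / y ^ 2)
     - y * b0 * ((x * w * (x ^ (k + 3) * B)
        + x * z * (x ^ (k + 3) * B + κ * x ^ (k + 1) * y ^ (k + 1))) / x ^ 2)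
    = y ^ (k + 3) * (x ^ (k + 2) * (b2 * (u * (x ^ 2 * B) + v * (x ^ 2 * B + κ * y ^ (k + 1)))
        / y ^ (k + 4)
      - b0 * (w + z) * B / y ^ (k + 2) - κ * H / y)
      - κ * (h0 * x ^ k + h1 * x ^ (k + 1))) := by
  simp only [pow_add]
  field_simp
  linear_combination (-(κ * y ^ 3 * y ^ k)) * hH

/-- Proposition "order p+2": the solutions of the order `p+2` transport system,
sourced by the order `p+1` homogeneous solution `(A₀, A₂)`, contain logarithmic
divergences at `τ = 1`: at least one of `a₀`, `a₂` does not extend smoothly to `(-1,1]`. -/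
theorem order_p_plus_two_logarithmic_divergence (p : ℕ) (hp : 1 ≤ p) (m : ℝ) (hm : m ≠ 0)
    (A₂ : Polynomial ℝ)
    (hA : ∀ τ ∈ Set.Ioo (-1 : ℝ) 1,
      (1 + τ) * deriv (A₀ p) τ + ((p : ℝ) / 2 * (1 + τ) - (p : ℝ)) * A₀ p τ
          + (p : ℝ) / 2 * (1 - τ) * A₂.eval τ = 0 ∧
      (1 - τ) * deriv (fun t : ℝ => A₂.eval t) τ - (p : ℝ) / 2 * (1 + τ) * A₀ p τ
          + (-((p : ℝ) / 2) * (1 - τ) + (p : ℝ)) * A₂.eval τ = 0)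
    (a₀ a₂ : ℝ → ℝ)
    (hd₀ : ∀ τ ∈ Set.Ioo (-1 : ℝ) 1, DifferentiableAt ℝ a₀ τ)
    (hd₂ : ∀ τ ∈ Set.Ioo (-1 : ℝ) 1, DifferentiableAt ℝ a₂ τ)
    (heq₀ : ∀ τ ∈ Set.Ioo (-1 : ℝ) 1,
      (1 + τ) * deriv a₀ τ
        + ((p : ℝ) * ((p : ℝ) + 1) / (2 * ((p : ℝ) + 2)) * (1 + τ) - (p : ℝ) - 1) * a₀ τ
        + (p : ℝ) * ((p : ℝ) + 1) / (2 * ((p : ℝ) + 2)) * (1 - τ) * a₂ τ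
        = (g₀ m p τ * A₀ p τ + g₂ m p τ * A₂.eval τ) / (1 + τ) ^ 2)
    (heq₂ : ∀ τ ∈ Set.Ioo (-1 : ℝ) 1,
      (1 - τ) * deriv a₂ τ
        - (p : ℝ) * ((p : ℝ) + 1) / (2 * ((p : ℝ) + 2)) * (1 + τ) * a₀ τ
        + (-((p : ℝ) * ((p : ℝ) + 1) / (2 * ((p : ℝ) + 2))) * (1 - τ) + (p : ℝ) + 1) * a₂ τ
        = (g₀ m p (-τ) * A₀ p τ + g₂ m p (-τ) * A₂.eval τ) / (1 - τ) ^ 2) :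
    (¬∃ F : ℝ → ℝ, ContDiffOn ℝ (⊤ : ℕ∞) F (Set.Ioc (-1 : ℝ) 1) ∧
        Set.EqOn a₀ F (Set.Ioo (-1 : ℝ) 1)) ∨
    (¬∃ F : ℝ → ℝ, ContDiffOn ℝ (⊤ : ℕ∞) F (Set.Ioc (-1 : ℝ) 1) ∧
        Set.EqOn a₂ F (Set.Ioo (-1 : ℝ) 1)) := by
  by_contra hcon
  push Not at hcon
  obtain ⟨⟨F, hF, hFe⟩, ⟨G, hG, hGe⟩⟩ := hcon
  obtain ⟨k, rfl⟩ : ∃ k, p = k + 1 := ⟨p - 1, by omega⟩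
  apply SS_one m hm k
  set κ : ℝ := 4 / ((k + 1) * 2 ^ (k + 1)) with hκ
  have hy : ∀ τ ∈ Set.Ioc (-1 : ℝ) 1, (1 + τ) ^ (k + 2) ≠ 0 := by
    intro τ hτ
    have : 0 < 1 + τ := by linarith [hτ.1]
    positivity
  refine smooth_key (k + 2) (fun τ =>
    (F τ * (((k : ℝ) + 1) - ((k : ℝ) + 1 + 1) * (1 - τ))
      - G τ * (((k : ℝ) + 1 + 2) - ((k : ℝ) + 1 + 1) * (1 - τ))) / (1 + τ) ^ (k + 2)
    + (κ * (h0 m (k + 1)) / 2 * (1 - τ) ^ k + κ * h1 m (k + 1) * (1 - τ) ^ (k + 1)))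
    (SS m k) ?_ (SS_smooth m k) ?_
  · refine ContDiffOn.add (ContDiffOn.div ?_ ?_ hy) ?_
    all_goals fun_prop
  intro τ hτ
  have hnhds := isOpen_Ioo.mem_nhds hτ
  have hFd : HasDerivAt F (deriv a₀ τ) τ :=
    (hd₀ τ hτ).hasDerivAt.congr_of_eventuallyEq (by
      filter_upwards [hnhds] with t ht using (hFe ht).symm)
  have hGd : HasDerivAt G (deriv a₂ τ) τ :=
    (hd₂ τ hτ).hasDerivAt.congr_of_eventuallyEq (by
      filter_upwards [hnhds] with t ht using (hGe ht).symm)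
  have e0 := heq₀ τ hτ
  have e2 := heq₂ τ hτ
  rw [A₂_eq k τ hτ.2 _ (hA τ hτ).1, hFe hτ, hGe hτ] at e0 e2
  have hA0 : A₀ (k + 1) τ = (1 - τ) ^ (k + 3) * BB (k + 1) τ := rfl
  rw [hA0] at e0 e2
  have hg0 : ∀ t, g₀ m (k + 1) t = (1 + t) * gt0 m (k + 1) t := by
    intro t; unfold g₀ gt0; push_cast; ring
  have hg2 : ∀ t, g₂ m (k + 1) t = (1 + t) * gt2 m (k + 1) t := by
    intro t; unfold g₂ gt2; push_cast; ring
  have hneg : 1 + -τ = 1 - τ := by ring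
  simp only [hg0, hg2, hneg, ← hκ] at e0 e2
  push_cast at e0 e2
  have hx : (1 - τ) ≠ 0 := by linarith [hτ.2]
  have hy1 : (1 + τ) ≠ 0 := by linarith [hτ.1]
  have halg := rhs_alg (1 - τ) (1 + τ) κ (BB (k + 1) τ) (gt0 m (k + 1) τ) (gt2 m (k + 1) τ)
    (gt0 m (k + 1) (-τ)) (gt2 m (k + 1) (-τ)) (h0 m (k + 1)) (h1 m (k + 1)) (Hn m (k + 1) τ)
    (((k : ℝ) + 1 + 2) - ((k : ℝ) + 1 + 1) * (1 - τ))
    (((k : ℝ) + 1) - ((k : ℝ) + 1 + 1) * (1 - τ)) k hx hy1 (Hn_spec m (k + 1) τ)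
  have h2x : (2 : ℝ) - (1 - τ) = 1 + τ := by ring
  have hw := wronsk ((k : ℝ) + 1) (1 - τ) (F τ) (G τ) (deriv a₀ τ) (deriv a₂ τ) _ _
    (by positivity) rfl rfl
  rw [h2x, e0, e2, halg] at hw
  change _ = (1 + τ) ^ (k + 3) * ((1 - τ) ^ (k + 2) * SS m k τ - _) at hw
  have hxd : HasDerivAt (fun t : ℝ => 1 - t) (-1) τ := by
    simpa using (hasDerivAt_id τ).const_sub 1
  have hyd : HasDerivAt (fun t : ℝ => 1 + t) 1 τ := by
    simpa using (hasDerivAt_id τ).const_add 1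
  have hb : ∀ q : ℝ, HasDerivAt (fun t : ℝ => q - ((k : ℝ) + 1 + 1) * (1 - t))
      ((k : ℝ) + 1 + 1) τ := by
    intro q
    have := (hxd.const_mul ((k : ℝ) + 1 + 1)).const_sub q
    simpa using this
  have hD := ((((hFd.fun_mul (hb ((k : ℝ) + 1))).fun_sub (hGd.fun_mul (hb ((k : ℝ) + 1 + 2)))).fun_div
    (hyd.fun_pow (k + 2)) (hy τ ⟨hτ.1, hτ.2.le⟩))).fun_add
    (((hxd.fun_pow k).const_mul (κ * (h0 m (k + 1)) / 2)).fun_add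
      ((hxd.fun_pow (k + 1)).const_mul (κ * h1 m (k + 1))))
  rw [hD.deriv]
  have hkk : (1 - τ) * ((k : ℝ) * (1 - τ) ^ (k - 1)) = k * (1 - τ) ^ k := by
    cases k with
    | zero => simp
    | succ n => simp [pow_succ]; ring
  generalize F τ * (((k : ℝ) + 1) - ((k : ℝ) + 1 + 1) * (1 - τ))
      - G τ * (((k : ℝ) + 1 + 2) - ((k : ℝ) + 1 + 1) * (1 - τ)) = W at *
  have hW' : deriv a₀ τ * ((k : ℝ) + 1 - ((k : ℝ) + 1 + 1) * (1 - τ)) + F τ * ((k : ℝ) + 1 + 1) -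
      (deriv a₂ τ * ((k : ℝ) + 1 + 2 - ((k : ℝ) + 1 + 1) * (1 - τ)) + G τ * ((k : ℝ) + 1 + 1))
      = ((1 + τ) ^ (k + 3) * ((1 - τ) ^ (k + 2) * SS m k τ
        - κ * (h0 m (k + 1) * (1 - τ) ^ k + h1 m (k + 1) * (1 - τ) ^ (k + 1)))
        - 2 * ((k : ℝ) + 1 + 1) * (1 - (1 - τ)) * W) / ((1 - τ) * (1 + τ)) := by
    rw [eq_div_iff (mul_ne_zero hx hy1)]
    linear_combination hw
  rw [hW']
  generalize SS m k τ = S at *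
  generalize h0 m (k + 1) = c0 at *
  generalize h1 m (k + 1) = c1 at *
  rw [show k + 2 - 1 = k + 1 by omega, show k + 1 - 1 = k by omega]
  push_cast
  have key : (1 - τ) * (((((1 + τ) ^ (k + 3) * ((1 - τ) ^ (k + 2) * S
        - κ * (c0 * (1 - τ) ^ k + c1 * (1 - τ) ^ (k + 1)))
        - 2 * ((k : ℝ) + 1 + 1) * (1 - (1 - τ)) * W) / ((1 - τ) * (1 + τ))) * (1 + τ) ^ (k + 2)
        - W * (((k : ℝ) + 2) * (1 + τ) ^ (k + 1) * 1)) / ((1 + τ) ^ (k + 2)) ^ 2)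
      + ((k : ℝ) + 2) * (W / (1 + τ) ^ (k + 2))
      = (1 - τ) ^ (k + 2) * S - κ * (c0 * (1 - τ) ^ k + c1 * (1 - τ) ^ (k + 1)) := by
    simp only [pow_add]
    field_simp
    ring
  have e : (1 - τ) ^ (k + 1) = (1 - τ) ^ k * (1 - τ) := pow_succ _ _
  linear_combination key - κ * c0 / 2 * hkk + κ * c1 * (k + 2 - (k + 1)) * e
end

section
/- Let p ≥ 1 be an integer and define on (−1,1) the function w(τ) = ((1−τ)/2)^{p+1}·((1+τ)/2)^{p−1}·∫₀^τ (1+s)^{−p}(1−s)^{−p−2} ds. Then w satisfies (1−τ²)·w″(τ) + (2 − (2−2p)τ)·w′(τ) + 2p·w(τ) = 0 on (−1,1), w is not the restriction to (−1,1) of any polynomial function, and w does not extend to a C^∞ function on [−1,1). -/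
/-- The non-polynomial second solution of the degenerate Jacobi equation of the
`2^p`-polar sector of the order-`p` Maxwell transport equations. -/
noncomputable def wfun (p : ℕ) : ℝ → ℝ := fun τ =>
  ((1 - τ) / 2) ^ (p + 1) * ((1 + τ) / 2) ^ (p - 1)
    * ∫ s in (0 : ℝ)..τ, ((1 + s) ^ p)⁻¹ * ((1 - s) ^ (p + 2))⁻¹

theorem wfun_hasDerivAt (p : ℕ) (hp : 1 ≤ p) (t : ℝ) (ht : t ∈ Set.Ioo (-1 : ℝ) 1) :
    HasDerivAt (wfun p) (((1/4 : ℝ) ^ p - (2 + 2 * p * t) * wfun p t) / (1 - t ^ 2)) t := by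
  obtain ⟨h1, h2⟩ := ht
  have a1 : (1 + t) ≠ 0 := by linarith
  have a2 : (1 - t) ≠ 0 := by linarith
  set g : ℝ → ℝ := fun s => ((1 + s) ^ p)⁻¹ * ((1 - s) ^ (p + 2))⁻¹ with hg
  have gc : ContinuousOn g (Set.Ioo (-1 : ℝ) 1) := by
    intro s hs
    have b1 : (1 + s) ^ p ≠ 0 := pow_ne_zero _ (by linarith [hs.1])
    have b2 : (1 - s) ^ (p + 2) ≠ 0 := pow_ne_zero _ (by linarith [hs.2])
    apply ContinuousAt.continuousWithinAt
    have c1 : ContinuousAt (fun s : ℝ => (1 + s) ^ p) s := by fun_prop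
    have c2 : ContinuousAt (fun s : ℝ => (1 - s) ^ (p + 2)) s := by fun_prop
    exact (c1.inv₀ b1).mul (c2.inv₀ b2)
  have hsub : Set.uIcc 0 t ⊆ Set.Ioo (-1 : ℝ) 1 :=
    (Set.ordConnected_Ioo).uIcc_subset (by norm_num) ⟨h1, h2⟩
  have hnh : Set.Ioo (-1 : ℝ) 1 ∈ nhds t := Ioo_mem_nhds h1 h2
  have hI : HasDerivAt (fun x => ∫ s in (0:ℝ)..x, g s) (g t) t :=
    intervalIntegral.integral_hasDerivAt_right ((gc.mono hsub).intervalIntegrable)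
      (gc.stronglyMeasurableAtFilter isOpen_Ioo t ⟨h1, h2⟩) (gc.continuousAt hnh)
  obtain ⟨k, rfl⟩ : ∃ k, p = k + 1 := ⟨p - 1, by omega⟩
  have e1 : HasDerivAt (fun x : ℝ => ((1 - x) / 2) ^ (k + 1 + 1))
      (((k + 1 + 1 : ℕ) : ℝ) * ((1 - t) / 2) ^ (k + 1) * (-1 / 2)) t := by
    have := (((hasDerivAt_id t).const_sub 1).div_const 2).pow (k + 1 + 1)
    refine this.congr_deriv ?_
    simp
  have key : HasDerivAt (fun x : ℝ => ((1 + x) / 2) ^ k)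
      ((k : ℝ) * ((1 + t) / 2) ^ k / (1 + t)) t := by
    have := (((hasDerivAt_id t).const_add 1).div_const 2).pow k
    refine this.congr_deriv ?_
    rcases k with _ | k
    · simp
    · simp only [id, Nat.add_sub_cancel]
      field_simp
      try ring
  have := (e1.mul key).mul hI
  refine this.congr_deriv ?_
  simp only [wfun, Nat.add_sub_cancel, Pi.mul_apply]
  change _ = (_ - _ * (_ * ∫ s in (0:ℝ)..t, g s)) / _
  generalize (∫ s in (0:ℝ)..t, g s) = J
  have a3 : (1 - t ^ 2) ≠ 0 := by
    have : (1 - t ^ 2) = (1 - t) * (1 + t) := by ring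
    rw [this]; exact mul_ne_zero a2 a1
  have h4 : (1/4 : ℝ) ^ (k+1) = (1/2)^(k+1) * (1/2)^(k+1) := by rw [← mul_pow]; norm_num
  have hgt : ((1 - t) / 2) ^ (k + 1 + 1) * ((1 + t) / 2) ^ k * g t
      = (1/4 : ℝ) ^ (k+1) / (1 - t ^ 2) := by
    have : (1 - t ^ 2) = (1 - t) * (1 + t) := by ring
    rw [this, h4]
    simp only [hg, div_pow]
    field_simp
    try ring
  rw [hgt, eq_div_iff a3, add_mul, div_mul_cancel₀ _ a3]
  push_cast
  field_simp
  ring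

theorem wfun_hasDerivAt2 (p : ℕ) (hp : 1 ≤ p) (t : ℝ) (ht : t ∈ Set.Ioo (-1 : ℝ) 1) :
    (1 - t ^ 2) * deriv (deriv (wfun p)) t
        + (2 - (2 - 2 * (p : ℝ)) * t) * deriv (wfun p) t
        + 2 * (p : ℝ) * wfun p t = 0 := by
  have hev : deriv (wfun p) =ᶠ[nhds t]
      fun x => ((1/4 : ℝ) ^ p - (2 + 2 * p * x) * wfun p x) / (1 - x ^ 2) := by
    filter_upwards [Ioo_mem_nhds ht.1 ht.2] with x hx
    exact (wfun_hasDerivAt p hp x hx).deriv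
  have hw := wfun_hasDerivAt p hp t ht
  have a3 : (1 - t ^ 2) ≠ 0 := by nlinarith [ht.1, ht.2]
  have hn : HasDerivAt (fun x : ℝ => 2 + 2 * p * x) (2 * p) t := by
    simpa using ((hasDerivAt_id t).const_mul (2 * (p:ℝ))).const_add 2
  have hd : HasDerivAt (fun x : ℝ => 1 - x ^ 2) (-(2 * t)) t := by
    simpa using ((hasDerivAt_id t).pow 2).const_sub 1
  have := (((hn.mul hw).const_sub ((1/4 : ℝ) ^ p)).div hd a3)
  have h2 := this.deriv
  rw [hev.deriv_eq]
  erw [h2]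
  rw [hw.deriv]
  simp only [Pi.mul_apply]
  field_simp
  ring

theorem wfun_not_smooth (p : ℕ) (hp : 1 ≤ p) (F : ℝ → ℝ)
    (hF : ContDiffOn ℝ (⊤ : ℕ∞) F (Set.Ico (-1 : ℝ) 1))
    (hE : Set.EqOn (wfun p) F (Set.Ioo (-1 : ℝ) 1)) : False := by
  have hu : UniqueDiffOn ℝ (Set.Ico (-1 : ℝ) 1) := uniqueDiffOn_Ico _ _
  obtain ⟨G, hG⟩ : ∃ G : ℕ → ℝ → ℝ, G = fun n => iteratedDerivWithin n F (Set.Ico (-1 : ℝ) 1) :=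
    ⟨_, rfl⟩
  have G0 : G 0 = F := by rw [hG]; simp
  have Gc : ∀ n, ContinuousOn (G n) (Set.Ico (-1 : ℝ) 1) := by
    intro n; rw [hG]
    exact hF.continuousOn_iteratedDerivWithin (by exact_mod_cast le_top) hu
  have Gd : ∀ n, ∀ t ∈ Set.Ioo (-1 : ℝ) 1, HasDerivAt (G n) (G (n+1) t) t := by
    intro n t ht
    have h1 := hF.differentiableOn_iteratedDerivWithin (m := n)
      (by exact_mod_cast ENat.natCast_lt_top n) hu t ⟨ht.1.le, ht.2⟩
    have h2 := h1.hasDerivWithinAt.hasDerivAt (Ico_mem_nhds ht.1 ht.2)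
    rw [hG]
    simpa only [iteratedDerivWithin_succ] using h2
  clear hG hF hu
  have hwF : ∀ t ∈ Set.Ioo (-1 : ℝ) 1, wfun p =ᶠ[nhds t] G 0 := by
    intro t ht
    rw [G0]
    filter_upwards [Ioo_mem_nhds ht.1 ht.2] with x hx using hE hx
  have E0 : ∀ t ∈ Set.Ioo (-1 : ℝ) 1,
      (1 - t ^ 2) * G 1 t + (2 + 2 * p * t) * G 0 t - (1/4 : ℝ) ^ p = 0 := by
    intro t ht
    have a3 : (1 - t ^ 2) ≠ 0 := by nlinarith [ht.1, ht.2]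
    have h := (Gd 0 t ht).unique ((wfun_hasDerivAt p hp t ht).congr_of_eventuallyEq (hwF t ht).symm)
    rw [(hwF t ht).eq_of_nhds] at h
    rw [zero_add] at h
    rw [h]
    field_simp
    ring
  have E : ∀ n : ℕ, ∀ t ∈ Set.Ioo (-1 : ℝ) 1,
      (1 - t ^ 2) * G (n+2) t + (2 + (2 * p - 2 * n - 2) * t) * G (n+1) t
        + (n+1) * (2 * p - n) * G n t = 0 := by
    have hd : ∀ t : ℝ, HasDerivAt (fun x : ℝ => 1 - x ^ 2) (-(2 * t)) t := fun t => by
      simpa using ((hasDerivAt_id t).pow 2).const_sub 1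
    have hn : ∀ a t : ℝ, HasDerivAt (fun x : ℝ => 2 + a * x) a t := fun a t => by
      simpa using ((hasDerivAt_id t).const_mul a).const_add 2
    have hz : ∀ (H : ℝ → ℝ) (d t : ℝ), t ∈ Set.Ioo (-1 : ℝ) 1 → HasDerivAt H d t →
        (∀ x ∈ Set.Ioo (-1 : ℝ) 1, H x = 0) → d = 0 := by
      intro H d t ht h h0
      refine h.unique ((hasDerivAt_const t (0:ℝ)).congr_of_eventuallyEq ?_)
      filter_upwards [Ioo_mem_nhds ht.1 ht.2] with x hx using h0 x hx
    intro n
    induction n with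
    | zero =>
      intro t ht
      have := hz _ _ t ht ((((hd t).mul (Gd 1 t ht)).add
        ((hn (2 * p) t).mul (Gd 0 t ht))).sub_const ((1/4 : ℝ) ^ p)) E0
      simp only [zero_add, Nat.cast_zero] at this ⊢
      norm_num at this
      linear_combination this
    | succ n ih =>
      intro t ht
      have := hz _ _ t ht ((((hd t).mul (Gd (n+2) t ht)).add
        ((hn (2 * p - 2 * n - 2) t).mul (Gd (n+1) t ht))).add
          ((Gd n t ht).const_mul (((n:ℝ)+1) * (2 * p - n)))) ih
      push_cast
      have e : n + 1 + 2 = n + 2 + 1 := rfl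
      have e' : n + 1 + 1 = n + 2 := rfl
      rw [e, e']
      rw [e'] at this
      linear_combination this
  have hcl : ∀ H : ℝ → ℝ, ContinuousOn H (Set.Ico (-1 : ℝ) 1) →
      (∀ x ∈ Set.Ioo (-1 : ℝ) 1, H x = 0) → H (-1) = 0 := by
    intro H hH h0
    have h1 : Filter.Tendsto H (nhdsWithin (-1) (Set.Ioo (-1 : ℝ) 1)) (nhds (H (-1))) :=
      (hH (-1) (by norm_num)).mono_left (nhdsWithin_mono _ Set.Ioo_subset_Ico_self)
    have h2 : Filter.Tendsto H (nhdsWithin (-1) (Set.Ioo (-1 : ℝ) 1)) (nhds 0) := by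
      refine tendsto_const_nhds.congr' ?_
      filter_upwards [self_mem_nhdsWithin] with x hx using (h0 x hx).symm
    have : (nhdsWithin (-1) (Set.Ioo (-1 : ℝ) 1)).NeBot := left_nhdsWithin_Ioo_neBot (by norm_num)
    exact tendsto_nhds_unique h1 h2
  have B0 : (2 - 2 * (p:ℝ)) * G 0 (-1) = (1/4 : ℝ) ^ p := by
    have c0 := Gc 0
    have c1 := Gc 1
    have := hcl _ (by fun_prop) E0
    linear_combination this
  have B : ∀ n : ℕ, (2 * (n:ℝ) + 4 - 2 * p) * G (n+1) (-1) + (n+1) * (2 * p - n) * G n (-1) = 0 := by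
    intro n
    have c0 := Gc n
    have c1 := Gc (n+1)
    have c2 := Gc (n+2)
    have := hcl _ (by fun_prop) (E n)
    linear_combination this
  have hpos : (0:ℝ) < (1/4 : ℝ) ^ p := by positivity
  obtain ⟨k, rfl⟩ : ∃ k, p = k + 1 := ⟨p - 1, by omega⟩
  rcases k with _ | m
  · norm_num at B0
  · have D : ∀ j n : ℕ, n + j = m → G n (-1) = 0 := by
      intro j
      induction j with
      | zero =>
        intro n hnm
        have hb := B n
        have hm : (m:ℝ) = n := by exact_mod_cast hnm.symm
        push_cast at hb
        rw [hm] at hb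
        have h3 : ((n:ℝ)+1) * (n + 4) * G n (-1) = 0 := by linear_combination hb
        have h4 : ((n:ℝ)+1) * (n + 4) ≠ 0 := by positivity
        exact (mul_eq_zero.mp h3).resolve_left h4
      | succ j ih =>
        intro n hnm
        have hb := B n
        rw [ih (n+1) (by omega)] at hb
        have hm : (m:ℝ) = n + (j + 1) := by exact_mod_cast hnm.symm
        push_cast at hb
        rw [hm] at hb
        have h3 : ((n:ℝ)+1) * (n + 2 * j + 6) * G n (-1) = 0 := by linear_combination hb
        have h4 : ((n:ℝ)+1) * (n + 2 * j + 6) ≠ 0 := by positivity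
        exact (mul_eq_zero.mp h3).resolve_left h4
    rw [D m 0 (by omega)] at B0
    linarith

/-- `wfun p` solves the degenerate Jacobi equation on `(-1,1)`, is not polynomial,
and does not extend to a `C^∞` function on `[-1,1)`. -/
theorem second_solution_is_singular (p : ℕ) (hp : 1 ≤ p) :
    (∀ τ ∈ Set.Ioo (-1 : ℝ) 1,
      (1 - τ ^ 2) * deriv (deriv (wfun p)) τ
        + (2 - (2 - 2 * (p : ℝ)) * τ) * deriv (wfun p) τ
        + 2 * (p : ℝ) * wfun p τ = 0) ∧
    (¬∃ P : Polynomial ℝ, ∀ τ ∈ Set.Ioo (-1 : ℝ) 1, wfun p τ = P.eval τ) ∧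
    (¬∃ F : ℝ → ℝ, ContDiffOn ℝ (⊤ : ℕ∞) F (Set.Ico (-1 : ℝ) 1) ∧
        Set.EqOn (wfun p) F (Set.Ioo (-1 : ℝ) 1)) := by
  refine ⟨fun t ht => wfun_hasDerivAt2 p hp t ht, ?_, ?_⟩
  · rintro ⟨P, hP⟩
    exact wfun_not_smooth p hp (fun x => P.eval x) (P.contDiff_aeval (𝕜 := ℝ) _).contDiffOn hP
  · rintro ⟨F, hF, hE⟩
    exact wfun_not_smooth p hp F hF hE
end

section
/- Let p ≥ 1 be an integer and define the polynomial A₀(τ) = (1−τ)^{p+2} · Σ_{m=0}^{p−1} C(p−1,m) · (1/(p+2+m)) · ((τ−1)/2)^m. Then there exists a unique polynomial A₂ such that the pair (A₀,A₂) satisfies on (−1,1) the homogeneous system (1+τ)·A₀′ + ((p/2)(1+τ) − p)·A₀ + (p/2)(1−τ)·A₂ = 0 and (1−τ)·A₂′ − (p/2)(1+τ)·A₀ + (−(p/2)(1−τ) + p)·A₂ = 0. In particular, the homogeneous system S_{p+1,p} admits a nonzero polynomial solution whose first component is divisible by (1−τ)^{p+2}. -/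
open Finset

open Polynomial in
noncomputable def B0aux (p : ℕ) : Polynomial ℝ :=
  (1 - X) ^ (p + 2) * ∑ m ∈ Finset.range p,
    C ((Nat.choose (p - 1) m : ℝ) * (1 / ((p : ℝ) + 2 + m))) * (C (1/2) * (X - 1)) ^ m

open Polynomial in
noncomputable def B2aux (p : ℕ) : Polynomial ℝ :=
  C (4 / (p : ℝ)) * (1 - X) ^ p * (C (1/2) * (1 + X)) ^ p + B0aux p

theorem B0aux_eval (p : ℕ) (τ : ℝ) : (B0aux p).eval τ = A₀ p τ := by
  simp only [B0aux, A₀, Polynomial.eval_mul, Polynomial.eval_pow, Polynomial.eval_sub,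
    Polynomial.eval_one, Polynomial.eval_X, Polynomial.eval_finsetSum, Polynomial.eval_C]
  congr 1
  refine Finset.sum_congr rfl fun m _ => ?_
  congr 2
  ring

theorem B2aux_eval (p : ℕ) (τ : ℝ) :
    (B2aux p).eval τ = 4 / (p : ℝ) * (1 - τ) ^ p * ((1 + τ) / 2) ^ p + A₀ p τ := by
  simp only [B2aux, Polynomial.eval_mul, Polynomial.eval_pow, Polynomial.eval_sub,
    Polynomial.eval_add, Polynomial.eval_one, Polynomial.eval_X, Polynomial.eval_C, B0aux_eval]
  congr 3
  ring

theorem A₀_hasDerivAt (n : ℕ) (τ : ℝ) :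
    HasDerivAt (A₀ (n + 1)) (-((1 - τ) ^ (n + 2) * ((1 + τ) / 2) ^ n)) τ := by
  have h1 : A₀ (n + 1) = fun t => ∑ m ∈ Finset.range (n + 1),
      ((Nat.choose n m : ℝ) * (1 / ((n : ℝ) + 3 + m)) * (-1 / 2) ^ m) * (1 - t) ^ (n + 3 + m) := by
    funext t
    simp only [A₀]
    rw [Finset.mul_sum]
    refine Finset.sum_congr rfl fun m _ => ?_
    have e : (t - 1) / 2 = (-1 / 2) * (1 - t) := by ring
    rw [e, mul_pow, pow_add (1 - t) (n + 3) m]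
    have e2 : ((n + 1 : ℕ) : ℝ) + 2 + m = (n : ℝ) + 3 + m := by push_cast; ring
    rw [e2]
    simp only [Nat.add_sub_cancel]
    ring
  have h2 : -((1 - τ) ^ (n + 2) * ((1 + τ) / 2) ^ n) = ∑ m ∈ Finset.range (n + 1),
      ((Nat.choose n m : ℝ) * (1 / ((n : ℝ) + 3 + m)) * (-1 / 2) ^ m) *
        (((n + 3 + m : ℕ) : ℝ) * (1 - τ) ^ (n + 3 + m - 1) * (-1)) := by
    have e : (1 + τ) / 2 = (-1 / 2) * (1 - τ) + 1 := by ring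
    rw [e, add_pow, Finset.mul_sum, ← Finset.sum_neg_distrib]
    refine Finset.sum_congr rfl fun m _ => ?_
    have e3 : n + 3 + m - 1 = n + 2 + m := by omega
    have hpos : (n : ℝ) + 3 + m ≠ 0 := by positivity
    rw [e3, mul_pow, pow_add (1 - τ) (n + 2) m, one_pow]
    push_cast
    field_simp
  rw [h1, h2]
  refine HasDerivAt.fun_sum fun m _ => ?_
  refine HasDerivAt.const_mul _ ?_
  exact ((hasDerivAt_id τ).const_sub 1).pow (n + 3 + m)

theorem B2aux_hasDerivAt (n : ℕ) (τ : ℝ) :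
    HasDerivAt (fun t : ℝ => (B2aux (n + 1)).eval t)
      (-4 * (1 - τ) ^ n * ((1 + τ) / 2) ^ (n + 1) + 2 * (1 - τ) ^ (n + 1) * ((1 + τ) / 2) ^ n
        - (1 - τ) ^ (n + 2) * ((1 + τ) / 2) ^ n) τ := by
  simp only [B2aux_eval]
  have ha := (((hasDerivAt_id τ).const_sub 1).pow (n + 1)).const_mul (4 / ((n + 1 : ℕ) : ℝ))
  have hb := (((hasDerivAt_id τ).const_add 1).div_const 2).pow (n + 1)
  refine ((ha.mul hb).add (A₀_hasDerivAt n τ)).congr_deriv ?_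
  have hpos : (n : ℝ) + 1 ≠ 0 := by positivity
  simp only [id, Nat.add_sub_cancel, Pi.pow_apply]
  push_cast
  field_simp
  ring

theorem aux_system (p : ℕ) (hp : 1 ≤ p) (τ : ℝ) :
    (1 + τ) * deriv (A₀ p) τ + ((p : ℝ) / 2 * (1 + τ) - (p : ℝ)) * A₀ p τ
          + (p : ℝ) / 2 * (1 - τ) * (B2aux p).eval τ = 0 ∧
      (1 - τ) * deriv (fun t : ℝ => (B2aux p).eval t) τ - (p : ℝ) / 2 * (1 + τ) * A₀ p τ
          + (-((p : ℝ) / 2) * (1 - τ) + (p : ℝ)) * (B2aux p).eval τ = 0 := by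
  obtain ⟨n, rfl⟩ : ∃ n, p = n + 1 := ⟨p - 1, by omega⟩
  have hpos : (n : ℝ) + 1 ≠ 0 := by positivity
  rw [(A₀_hasDerivAt n τ).deriv, (B2aux_hasDerivAt n τ).deriv, B2aux_eval]
  generalize A₀ (n + 1) τ = a
  obtain ⟨u, rfl⟩ : ∃ u, τ = 2 * u - 1 := ⟨(τ + 1) / 2, by ring⟩
  have e : (1 + (2 * u - 1)) / 2 = u := by ring
  rw [e]
  push_cast
  simp only [pow_succ]
  generalize (1 - (2 * u - 1)) ^ n = y
  generalize u ^ n = z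
  constructor
  · field_simp
    ring
  · field_simp
    ring

/-- There is a unique polynomial `A₂` such that `(A₀, A₂)` solves the homogeneous
system `S_{p+1,p}` on `(-1,1)`; in particular `S_{p+1,p}` admits a nonzero
polynomial solution whose first component is divisible by `(1-τ)^(p+2)`. -/
theorem exists_unique_second_component (p : ℕ) (hp : 1 ≤ p) :
    (∃! A₂ : Polynomial ℝ, ∀ τ ∈ Set.Ioo (-1 : ℝ) 1,
      (1 + τ) * deriv (A₀ p) τ + ((p : ℝ) / 2 * (1 + τ) - (p : ℝ)) * A₀ p τ
          + (p : ℝ) / 2 * (1 - τ) * A₂.eval τ = 0 ∧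
      (1 - τ) * deriv (fun t : ℝ => A₂.eval t) τ - (p : ℝ) / 2 * (1 + τ) * A₀ p τ
          + (-((p : ℝ) / 2) * (1 - τ) + (p : ℝ)) * A₂.eval τ = 0) ∧
    (∃ B₀ B₂ : Polynomial ℝ, (B₀ ≠ 0 ∨ B₂ ≠ 0) ∧
      ((1 - Polynomial.X : Polynomial ℝ) ^ (p + 2) ∣ B₀) ∧
      ∀ τ ∈ Set.Ioo (-1 : ℝ) 1,
        (1 + τ) * deriv (fun t : ℝ => B₀.eval t) τ
            + ((p : ℝ) / 2 * (1 + τ) - (p : ℝ)) * B₀.eval τ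
            + (p : ℝ) / 2 * (1 - τ) * B₂.eval τ = 0 ∧
        (1 - τ) * deriv (fun t : ℝ => B₂.eval t) τ
            - (p : ℝ) / 2 * (1 + τ) * B₀.eval τ
            + (-((p : ℝ) / 2) * (1 - τ) + (p : ℝ)) * B₂.eval τ = 0) := by
  refine ⟨⟨B2aux p, fun τ _ => aux_system p hp τ, ?_⟩, B0aux p, B2aux p, ?_, ?_, ?_⟩
  · intro Q hQ
    refine Polynomial.eq_of_infinite_eval_eq _ _
      ((Set.Ioo_infinite (show (-1 : ℝ) < 1 by norm_num)).mono ?_)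
    intro τ hτ
    have h1 := (hQ τ hτ).1
    have h2 := (aux_system p hp τ).1
    have hne : (p : ℝ) / 2 * (1 - τ) ≠ 0 := by
      have : (0 : ℝ) < p := by exact_mod_cast hp
      have : 0 < 1 - τ := by linarith [hτ.2]
      positivity
    exact mul_left_cancel₀ hne (by linarith)
  · by_contra! h
    have h1 := B2aux_eval p 0
    rw [← B0aux_eval, h.1, h.2] at h1
    have : (0 : ℝ) < p := by exact_mod_cast hp
    have h3 : 0 < 4 / (p : ℝ) * (1 - 0) ^ p * ((1 + 0) / 2) ^ p := by
      norm_num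
      positivity
    simp only [Polynomial.eval_zero] at h1
    linarith
  · exact Dvd.intro _ rfl
  · intro τ _
    simp only [B0aux_eval]
    exact aux_system p hp τ
end

section
/- Let p ≥ 2 and 1 ≤ q ≤ p−1 be integers. Then every differentiable solution (a₀,a₂) : (−1,1) → ℝ of the homogeneous system S_{p,q} is the restriction to (−1,1) of a pair of polynomial functions. -/
open Polynomial in
lemma exists_antideriv (P : Polynomial ℝ) : ∃ Q : Polynomial ℝ, derivative Q = P := by
  induction P using Polynomial.induction_on' with
  | add a b ha hb =>
    obtain ⟨A, rfl⟩ := ha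
    obtain ⟨B, rfl⟩ := hb
    exact ⟨A + B, by simp⟩
  | monomial n a =>
    refine ⟨monomial (n + 1) (a / (n + 1)), ?_⟩
    rw [derivative_monomial]
    have : (n : ℝ) + 1 ≠ 0 := by positivity
    simp [this]

lemma const_of_deriv_zero (f : ℝ → ℝ) (h : ∀ τ ∈ Set.Ioo (-1 : ℝ) 1, HasDerivAt f 0 τ) :
    ∃ C : ℝ, ∀ τ ∈ Set.Ioo (-1 : ℝ) 1, f τ = C := by
  refine ⟨f 0, fun τ hτ => ?_⟩
  exact isOpen_Ioo.is_const_of_deriv_eq_zero isPreconnected_Ioo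
    (fun x hx => (h x hx).differentiableAt.differentiableWithinAt)
    (fun x hx => (h x hx).deriv) hτ (by norm_num)

lemma poly_of_deriv_poly (f g : ℝ → ℝ) (P : Polynomial ℝ)
    (h : ∀ τ ∈ Set.Ioo (-1 : ℝ) 1, HasDerivAt f (g τ) τ)
    (hg : ∀ τ ∈ Set.Ioo (-1 : ℝ) 1, g τ = P.eval τ) :
    ∃ Q : Polynomial ℝ, ∀ τ ∈ Set.Ioo (-1 : ℝ) 1, f τ = Q.eval τ := by
  obtain ⟨Q, hQ⟩ := exists_antideriv P
  obtain ⟨C, hC⟩ := const_of_deriv_zero (fun t => f t - Q.eval t) (fun t ht => by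
    have := (h t ht).sub (Q.hasDerivAt t)
    rw [hQ, hg t ht, sub_self] at this
    exact this)
  refine ⟨Q + Polynomial.C C, fun t ht => ?_⟩
  have := hC t ht
  simp only [Polynomial.eval_add, Polynomial.eval_C]
  linarith

lemma gegenbauer_poly (q m : ℕ) : ∀ (S S1 S2 : ℝ → ℝ),
    (∀ τ ∈ Set.Ioo (-1 : ℝ) 1, HasDerivAt S (S1 τ) τ) →
    (∀ τ ∈ Set.Ioo (-1 : ℝ) 1, HasDerivAt S1 (S2 τ) τ) →
    (∀ τ ∈ Set.Ioo (-1 : ℝ) 1, (1 - τ ^ 2) * S2 τ + 2 * ((m : ℝ) + q) * τ * S1 τ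
      - (m : ℝ) * (m + 2 * q + 1) * S τ = 0) →
    ∃ Q : Polynomial ℝ, ∀ τ ∈ Set.Ioo (-1 : ℝ) 1, S τ = Q.eval τ := by
  induction m with
  | zero =>
    intro S S1 S2 h1 h2 h
    have hpos : ∀ τ ∈ Set.Ioo (-1 : ℝ) 1, (1 - τ ^ 2) ≠ 0 := fun τ hτ => by
      have := hτ.1
      have := hτ.2
      nlinarith
    obtain ⟨C, hC⟩ := const_of_deriv_zero (fun t => S1 t / (1 - t ^ 2) ^ q) (fun t ht => by
      have hw : HasDerivAt (fun t : ℝ => 1 - t ^ 2) (-(2 * t)) t := by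
        simpa using (hasDerivAt_pow 2 t).const_sub 1
      have := (h2 t ht).div (hw.pow q) (pow_ne_zero q (hpos t ht))
      refine this.congr_deriv ?_
      have e := h t ht
      push_cast at e
      rw [div_eq_zero_iff]
      left
      simp only [Pi.pow_apply]
      rcases q with _ | k
      · have : S2 t = 0 := by
          have : (1 - t ^ 2) * S2 t = 0 := by simpa using e
          exact (mul_eq_zero.mp this).resolve_left (hpos t ht)
        simp [this]
      · simp only [Nat.add_sub_cancel]
        push_cast at e ⊢
        rw [pow_succ]
        linear_combination (1 - t ^ 2) ^ k * e)
    refine poly_of_deriv_poly S S1 (Polynomial.C C * (1 - Polynomial.X ^ 2) ^ q) h1 ?_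
    intro t ht
    have := hC t ht
    rw [div_eq_iff (pow_ne_zero q (hpos t ht))] at this
    simp [this]
  | succ m ih =>
    intro S S1 S2 h1 h2 h
    have hpos : ∀ τ ∈ Set.Ioo (-1 : ℝ) 1, (1 - τ ^ 2) ≠ 0 := fun τ hτ => by
      have := hτ.1
      have := hτ.2
      nlinarith
    have hd : ∀ τ ∈ Set.Ioo (-1 : ℝ) 1, HasDerivAt S2 (deriv S2 τ) τ := by
      intro t ht
      have hS := (h1 t ht).differentiableAt
      have hS1 := (h2 t ht).differentiableAt
      have : DifferentiableAt ℝ (fun τ => (((m + 1 : ℕ) : ℝ) * (((m + 1 : ℕ) : ℝ) + 2 * q + 1) * S τ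
          - 2 * (((m + 1 : ℕ) : ℝ) + q) * τ * S1 τ) / (1 - τ ^ 2)) t := by
        exact DifferentiableAt.fun_div (by fun_prop) (by fun_prop) (hpos t ht)
      refine (this.congr_of_eventuallyEq ?_).hasDerivAt
      filter_upwards [isOpen_Ioo.mem_nhds ht] with s hs
      rw [eq_div_iff (hpos s hs)]
      linear_combination h s hs
    obtain ⟨P, hP⟩ := ih S1 S2 (deriv S2) h2 hd (by
      intro t ht
      have hw : HasDerivAt (fun t : ℝ => 1 - t ^ 2) (-(2 * t)) t := by
        simpa using (hasDerivAt_pow 2 t).const_sub 1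
      have hl : HasDerivAt (fun t : ℝ => 2 * (((m + 1 : ℕ) : ℝ) + q) * t)
          (2 * (((m + 1 : ℕ) : ℝ) + q)) t := by
        simpa using (hasDerivAt_id t).const_mul (2 * (((m + 1 : ℕ) : ℝ) + q))
      have hF := ((hw.mul (hd t ht)).add (hl.mul (h2 t ht))).sub
        ((h1 t ht).const_mul (((m + 1 : ℕ) : ℝ) * (((m + 1 : ℕ) : ℝ) + 2 * q + 1)))
      have h0 := hF.congr_of_eventuallyEq (f₁ := fun _ => (0 : ℝ)) (by
        filter_upwards [isOpen_Ioo.mem_nhds ht] with s hs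
        exact (h s hs).symm)
      have e := h0.unique (hasDerivAt_const t (0 : ℝ))
      push_cast at e
      linear_combination e)
    exact poly_of_deriv_poly S S1 P h1 hP


/-- For `1 ≤ q ≤ p-1`, every differentiable solution of the homogeneous system
`S_{p,q}` on `(-1,1)` is the restriction of a pair of polynomial functions. -/
theorem Spq_solutions_polynomial (p q : ℕ) (hp : 2 ≤ p) (hq₁ : 1 ≤ q) (hq₂ : q ≤ p - 1)
    (a₀ a₂ : ℝ → ℝ)
    (hd₀ : ∀ τ ∈ Set.Ioo (-1 : ℝ) 1, DifferentiableAt ℝ a₀ τ)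
    (hd₂ : ∀ τ ∈ Set.Ioo (-1 : ℝ) 1, DifferentiableAt ℝ a₂ τ)
    (heq₀ : ∀ τ ∈ Set.Ioo (-1 : ℝ) 1,
      (1 + τ) * deriv a₀ τ
        + ((q : ℝ) * ((q : ℝ) + 1) / (2 * (p : ℝ)) * (1 + τ) - (p : ℝ) + 1) * a₀ τ
        + (q : ℝ) * ((q : ℝ) + 1) / (2 * (p : ℝ)) * (1 - τ) * a₂ τ = 0)
    (heq₂ : ∀ τ ∈ Set.Ioo (-1 : ℝ) 1,
      (1 - τ) * deriv a₂ τ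
        - (q : ℝ) * ((q : ℝ) + 1) / (2 * (p : ℝ)) * (1 + τ) * a₀ τ
        + (-((q : ℝ) * ((q : ℝ) + 1) / (2 * (p : ℝ))) * (1 - τ) + (p : ℝ) - 1) * a₂ τ = 0) :
    ∃ P Q : Polynomial ℝ, ∀ τ ∈ Set.Ioo (-1 : ℝ) 1,
      a₀ τ = P.eval τ ∧ a₂ τ = Q.eval τ := by
  obtain ⟨m, rfl⟩ : ∃ m, p = m + q + 1 := ⟨p - 1 - q, by omega⟩
  have hp0 : ((m + q + 1 : ℕ) : ℝ) ≠ 0 := by positivity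
  obtain ⟨c, hc⟩ : ∃ c, c = (q : ℝ) * ((q : ℝ) + 1) / (2 * ((m + q + 1 : ℕ) : ℝ)) := ⟨_, rfl⟩
  simp only [← hc] at heq₀ heq₂
  have hc' : 2 * c * ((m + q + 1 : ℕ) : ℝ) = (q : ℝ) * (q + 1) := by
    rw [hc]; field_simp
  obtain ⟨P, hP⟩ : ∃ P, P = ((m + q + 1 : ℕ) : ℝ) := ⟨_, rfl⟩
  rw [← hP] at hp0 hc'
  simp only [← hP] at heq₀ heq₂
  have hPm : P = m + q + 1 := by rw [hP]; push_cast; ring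
  have hS1 : ∀ t ∈ Set.Ioo (-1 : ℝ) 1,
      HasDerivAt (fun t => (1 + t) * a₀ t + (1 - t) * a₂ t) (P * (a₀ t - a₂ t)) t := by
    intro t ht
    have h := (((hasDerivAt_id t).const_add 1).mul (hd₀ t ht).hasDerivAt).add
      (((hasDerivAt_id t).const_sub 1).mul (hd₂ t ht).hasDerivAt)
    refine h.congr_deriv ?_
    simp only [id]
    linear_combination heq₀ t ht + heq₂ t ht
  have hS2 : ∀ t ∈ Set.Ioo (-1 : ℝ) 1,
      HasDerivAt (fun t => P * (a₀ t - a₂ t)) (P * (deriv a₀ t - deriv a₂ t)) t :=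
    fun t ht => ((hd₀ t ht).hasDerivAt.sub (hd₂ t ht).hasDerivAt).const_mul P
  obtain ⟨Q, hQ⟩ := gegenbauer_poly q m _ _ _ hS1 hS2 (by
    intro t ht
    have hm : (m : ℝ) = P - q - 1 := by rw [hPm]; ring
    rw [hm]
    linear_combination P * (1 - t) * heq₀ t ht - P * (1 + t) * heq₂ t ht
      - ((1 + t) * a₀ t + (1 - t) * a₂ t) * hc')
  obtain ⟨D, hD⟩ : ∃ D : Polynomial ℝ, ∀ t ∈ Set.Ioo (-1 : ℝ) 1, a₀ t - a₂ t = D.eval t := by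
    refine ⟨Polynomial.C P⁻¹ * Polynomial.derivative Q, fun t ht => ?_⟩
    have h := (Q.hasDerivAt t).congr_of_eventuallyEq
      (f₁ := fun t => (1 + t) * a₀ t + (1 - t) * a₂ t) (by
        filter_upwards [isOpen_Ioo.mem_nhds ht] with s hs
        exact hQ s hs)
    have e := h.unique (hS1 t ht)
    simp only [Polynomial.eval_mul, Polynomial.eval_C]
    rw [e]
    field_simp
  refine ⟨Polynomial.C (1/2) * (Q + (1 - Polynomial.X) * D),
    Polynomial.C (1/2) * (Q - (1 + Polynomial.X) * D), fun t ht => ?_⟩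
  have e1 := hQ t ht
  have e2 := hD t ht
  simp only [Polynomial.eval_mul, Polynomial.eval_C, Polynomial.eval_add, Polynomial.eval_sub,
    Polynomial.eval_one, Polynomial.eval_X, ← e1, ← e2]
  constructor <;> ring
end
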